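/- arXiv:2011.09521 — 7 statements merged into one kernel-verified Lean document; each statement's English description precedes it below -/
import Mathlib

section
/- Let n be a positive integer with gcd(n,6)=1 and n > 10^20. Let S = (a_1)(a_2)(a_3)(a_4) be a minimal zero-sum sequence over ℤ/n such that gcd(n, a_i) = 1 for each i (identifying each a_i with its least non-negative residue). Then ind(S) = 1. -/
/-- A sequence `a` of length `k` over `ℤ/n` is a minimal zero-sum sequence if it sums to zero
but no nonempty proper subsequence of it sums to zero. -/
def IsMinZeroSum (n : ℕ) {k : ℕ} (a : Fin k → ZMod n) : Prop :=
  (∑ j, a j = 0) ∧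
    ∀ s : Finset (Fin k), s.Nonempty → s ≠ Finset.univ → ∑ j ∈ s, a j ≠ 0

/-- The index of a sequence over `ℤ/n`: the minimum over units `g` of
`(1/n) · Σ_j (g·a_j)_n`, where `(x)_n` is the least non-negative residue. -/
noncomputable def seqIndex (n : ℕ) {k : ℕ} (a : Fin k → ZMod n) : ℚ :=
  if h : n = 0 then 0
  else
    haveI : NeZero n := ⟨h⟩
    (Finset.univ.inf' Finset.univ_nonempty
      (fun g : (ZMod n)ˣ => ∑ j, (((g : ZMod n) * a j).val : ℚ))) / n

open Filter Topology Finset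


/-- Summation by parts in the form used for Dirichlet's test. -/
lemma sum_range_mul_eq_add_sum_partial_sums {R : Type*} [CommRing R] (a w : ℕ → R) (N : ℕ) :
    ∑ k ∈ range N, a k * w k = (∑ k ∈ range N, a k) * w N +
      ∑ k ∈ range N, (∑ j ∈ range (k + 1), a j) * (w k - w (k + 1)) := by
  induction N with
  | zero => simp
  | succ N ih =>
    rw [sum_range_succ, ih, sum_range_succ (fun k ↦ (∑ j ∈ range (k + 1), a j) * _) N,
      sum_range_succ a N]
    ring

/-- Dirichlet's test, with an absolutely convergent expression for the sum. -/
lemma tendsto_sum_range_mul_of_bounded_partial_sums {a w : ℕ → ℂ} {b : ℕ → ℝ} {C : ℝ}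
    (ha : ∀ n, ‖∑ k ∈ range n, a k‖ ≤ C) (hw : Tendsto w atTop (𝓝 0))
    (hb : ∀ k, ‖w k - w (k + 1)‖ ≤ b k) (hbs : Summable b) :
    Tendsto (fun N ↦ ∑ k ∈ range N, a k * w k) atTop
      (𝓝 (∑' k, (∑ j ∈ range (k + 1), a j) * (w k - w (k + 1)))) := by
  have hC : 0 ≤ C := (norm_nonneg _).trans (ha 0)
  have hsum : Summable fun k ↦ (∑ j ∈ range (k + 1), a j) * (w k - w (k + 1)) := by
    refine Summable.of_norm_bounded (hbs.mul_left C) fun k ↦ ?_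
    rw [norm_mul]
    exact mul_le_mul (ha _) (hb k) (norm_nonneg _) hC
  have h0 : Tendsto (fun N ↦ (∑ k ∈ range N, a k) * w N) atTop (𝓝 0) := by
    refine squeeze_zero_norm (a := fun N ↦ C * ‖w N‖) (fun N ↦ ?_) ?_
    · rw [norm_mul]
      exact mul_le_mul_of_nonneg_right (ha _) (norm_nonneg _)
    · simpa using hw.norm.const_mul C
  simpa [sum_range_mul_eq_add_sum_partial_sums a w] using h0.add hsum.hasSum.tendsto_sum_nat

lemma norm_sum_range_pow_succ_le {z : ℂ} (hz : ‖z‖ = 1) (hz1 : z ≠ 1) (n : ℕ) :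
    ‖∑ k ∈ range n, z ^ (k + 1)‖ ≤ 2 / ‖z - 1‖ := by
  have h : ∑ k ∈ range n, z ^ (k + 1) = z * ((z ^ n - 1) / (z - 1)) := by
    rw [← geom_sum_eq hz1, mul_sum]
    exact sum_congr rfl fun k _ ↦ by ring
  rw [h, norm_mul, hz, one_mul, norm_div]
  gcongr
  calc ‖z ^ n - 1‖ ≤ ‖z ^ n‖ + ‖(1 : ℂ)‖ := norm_sub_le _ _
    _ = 2 := by rw [norm_pow, hz]; norm_num

lemma norm_rpow_neg_sub_rpow_neg_le {s : ℝ} (hs : 1 ≤ s) (hs2 : s ≤ 2) (k : ℕ) :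
    ‖(((k + 1 : ℝ) ^ (-s) : ℝ) : ℂ) - (((k + 1 : ℕ) + 1 : ℝ) ^ (-s) : ℝ)‖ ≤
      2 / (k + 1 : ℝ) ^ 2 := by
  have hx : (0 : ℝ) < k + 1 := by positivity
  set x : ℝ := k + 1 with hxdef
  have hx1 : 1 ≤ x := by simp [hxdef]
  have hy : ((k + 1 : ℕ) + 1 : ℝ) = x + 1 := by push_cast; ring
  rw [hy, ← Complex.ofReal_sub, Complex.norm_real, Real.norm_eq_abs]
  have hle : (x + 1) ^ (-s) ≤ x ^ (-s) :=
    Real.rpow_le_rpow_of_nonpos hx (by linarith) (by linarith)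
  rw [abs_of_nonneg (by linarith)]
  have h1 : (x + 1) ^ (-s) = x ^ (-s) * (x / (x + 1)) ^ s := by
    rw [Real.div_rpow hx.le (by positivity), Real.rpow_neg hx.le, Real.rpow_neg (by positivity)]
    have : x ^ s ≠ 0 := (Real.rpow_pos_of_pos hx s).ne'
    field_simp
  have h2 : (x / (x + 1)) ^ (2 : ℝ) ≤ (x / (x + 1)) ^ s :=
    Real.rpow_le_rpow_of_exponent_ge (by positivity) (by rw [div_le_one (by positivity)]; linarith)
      hs2
  have h3 : x ^ (-s) ≤ x ^ (-1 : ℝ) := Real.rpow_le_rpow_of_exponent_le hx1 (by linarith)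
  rw [Real.rpow_neg_one] at h3
  rw [Real.rpow_two] at h2
  have h4 : 1 - (x / (x + 1)) ^ 2 ≤ 2 / x := by
    rw [div_pow, sub_le_iff_le_add, ← sub_le_iff_le_add', le_div_iff₀ (by positivity),
      sub_mul, div_mul_eq_mul_div, sub_le_iff_le_add, ← sub_le_iff_le_add', le_div_iff₀ hx]
    nlinarith
  have h5 : (x / (x + 1)) ^ 2 ≤ 1 :=
    pow_le_one₀ (by positivity) (by rw [div_le_one (by positivity)]; linarith)
  calc x ^ (-s) - (x + 1) ^ (-s) = x ^ (-s) * (1 - (x / (x + 1)) ^ s) := by rw [h1]; ring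
    _ ≤ x ^ (-s) * (1 - (x / (x + 1)) ^ 2) := by gcongr
    _ ≤ x⁻¹ * (2 / x) := mul_le_mul h3 h4 (by linarith) (by positivity)
    _ = 2 / x ^ 2 := by field_simp

/-- The value of the periodic zeta function at `s = 1`. -/
lemma expZeta_one {a : ℝ} (ha : (a : UnitAddCircle) ≠ 0) :
    HurwitzZeta.expZeta a 1 = -Complex.log (1 - Complex.exp (2 * Real.pi * Complex.I * a)) := by
  set z := Complex.exp (2 * Real.pi * Complex.I * a) with hzdef
  have hz : ‖z‖ = 1 := by
    rw [hzdef, show (2 * Real.pi * Complex.I * a : ℂ) = ((2 * Real.pi * a : ℝ) : ℂ) * Complex.I by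
      push_cast; ring, Complex.norm_exp_ofReal_mul_I]
  have hz1 : z ≠ 1 := by
    intro h
    obtain ⟨m, hm⟩ := Complex.exp_eq_one_iff.mp h
    refine ha ((AddCircle.coe_eq_zero_iff 1).mpr ⟨m, ?_⟩)
    have h2 : (2 * Real.pi * Complex.I : ℂ) ≠ 0 := Complex.two_pi_I_ne_zero
    have : (a : ℂ) = m := mul_left_cancel₀ h2 (by rw [hm]; ring)
    have : a = m := by exact_mod_cast this
    simp [this]
  set A : ℕ → ℂ := fun n ↦ ∑ k ∈ range n, z ^ (k + 1)
  let w : ℝ → ℕ → ℂ := fun s k ↦ (((k + 1 : ℝ) ^ (-s) : ℝ) : ℂ)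
  let T : ℝ → ℂ := fun s ↦ ∑' k, A (k + 1) * (w s k - w s (k + 1))
  have hbs : Summable fun k : ℕ ↦ 2 / (k + 1 : ℝ) ^ 2 := by
    have := ((summable_nat_add_iff 1).mpr
      (Real.summable_one_div_nat_pow.mpr one_lt_two)).mul_left 2
    refine this.congr fun k ↦ ?_
    push_cast; ring
  have hT (s : ℝ) (hs : 1 ≤ s) (hs2 : s ≤ 2) :
      Tendsto (fun N ↦ ∑ k ∈ range N, z ^ (k + 1) * w s k) atTop (𝓝 (T s)) := by
    refine tendsto_sum_range_mul_of_bounded_partial_sums (norm_sum_range_pow_succ_le hz hz1) ?_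
      (norm_rpow_neg_sub_rpow_neg_le hs hs2) hbs
    have h1 : Tendsto (fun k : ℕ ↦ (k + 1 : ℝ) ^ (-s)) atTop (𝓝 0) :=
      (tendsto_rpow_neg_atTop (by linarith)).comp
        (tendsto_atTop_add_const_right _ 1 tendsto_natCast_atTop_atTop)
    exact (Complex.continuous_ofReal.tendsto 0).comp h1
  have hexp (s : ℝ) (hs : 1 < s) (hs2 : s ≤ 2) : HurwitzZeta.expZeta a s = T s := by
    have h := (HurwitzZeta.hasSum_expZeta_of_one_lt_re a (s := s) (by simpa)).tendsto_sum_nat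
    refine tendsto_nhds_unique ((tendsto_add_atTop_iff_nat 1).mpr h) ?_
    refine (hT s hs.le hs2).congr fun N ↦ ?_
    rw [sum_range_succ']
    simp only [Nat.cast_zero, Complex.zero_cpow
      (show (s : ℂ) ≠ 0 by exact_mod_cast (by linarith : s ≠ 0)), div_zero, add_zero]
    refine sum_congr rfl fun k _ ↦ ?_
    have hw : w s k = ((k + 1 : ℂ) ^ (s : ℂ))⁻¹ := by
      simp only [w]
      rw [Real.rpow_neg (by positivity), Complex.ofReal_inv, Complex.ofReal_cpow (by positivity)]
      push_cast
      rfl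
    rw [hzdef, ← Complex.exp_nat_mul, hw, div_eq_mul_inv]
    push_cast
    ring_nf
  have hTlim : Tendsto T (𝓝[>] 1) (𝓝 (T 1)) := by
    refine tendsto_tsum_of_dominated_convergence
      (bound := fun k : ℕ ↦ 2 / ‖z - 1‖ * (2 / (k + 1 : ℝ) ^ 2)) (hbs.mul_left _)
      (fun k ↦ ?_) ?_
    · refine (Tendsto.mono_left ?_ nhdsWithin_le_nhds)
      have hc (x : ℝ) (hx : 0 < x) : Tendsto (fun s : ℝ ↦ ((x ^ (-s) : ℝ) : ℂ)) (𝓝 1)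
          (𝓝 ((x ^ (-1 : ℝ) : ℝ) : ℂ)) :=
        (Complex.continuous_ofReal.tendsto _).comp
          ((Real.continuous_const_rpow hx.ne').comp continuous_neg |>.tendsto 1)
      exact ((hc _ (by positivity)).sub (hc _ (by positivity))).const_mul _
    · filter_upwards [Ioc_mem_nhdsGT (show (1 : ℝ) < 2 by norm_num)] with s hs k
      rw [norm_mul]
      exact mul_le_mul (norm_sum_range_pow_succ_le hz hz1 _)
        (norm_rpow_neg_sub_rpow_neg_le hs.1.le hs.2 k) (norm_nonneg _) (by positivity)
  have hexp1 : HurwitzZeta.expZeta a 1 = T 1 := by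
    have hcont : Tendsto (fun s : ℝ ↦ HurwitzZeta.expZeta a s) (𝓝[>] 1)
        (𝓝 (HurwitzZeta.expZeta a 1)) := by
      have := ((HurwitzZeta.differentiable_expZeta_of_ne_zero ha).continuous.comp
        Complex.continuous_ofReal).tendsto 1
      rw [Function.comp_apply, Complex.ofReal_one] at this
      exact this.mono_left nhdsWithin_le_nhds
    refine tendsto_nhds_unique hcont (hTlim.congr' ?_)
    filter_upwards [Ioc_mem_nhdsGT (show (1 : ℝ) < 2 by norm_num)] with s hs
    exact (hexp s hs.1 hs.2).symm
  have hAbel : Tendsto (fun N ↦ ∑ n ∈ range N, z ^ n / n) atTop (𝓝 (T 1)) := by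
    refine (tendsto_add_atTop_iff_nat 1).mp ((hT 1 le_rfl one_le_two).congr fun N ↦ ?_)
    rw [sum_range_succ']
    simp [w, Real.rpow_neg_one, div_eq_mul_inv]
  have hlim := Complex.tendsto_tsum_powerSeries_nhdsWithin_lt hAbel
  have hre : z.re < 1 := by
    refine lt_of_le_of_ne (hz ▸ Complex.re_le_norm z) fun h ↦ hz1 ?_
    have h2 := Complex.sq_norm z
    rw [hz, Complex.normSq_apply, h] at h2
    refine Complex.ext (by simpa using h) ?_
    have : z.im * z.im = 0 := by linarith
    simpa using this
  have hlog : Tendsto (fun r : ℝ ↦ -Complex.log (1 - z * r)) (𝓝[<] 1)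
      (𝓝 (-Complex.log (1 - z))) := by
    refine Tendsto.mono_left ?_ nhdsWithin_le_nhds
    have : ContinuousAt (fun r : ℝ ↦ -Complex.log (1 - z * r)) 1 := by
      refine ContinuousAt.neg (ContinuousAt.clog (by fun_prop) (Or.inl ?_))
      simpa using hre
    simpa using this.tendsto
  rw [hexp1]
  refine tendsto_nhds_unique (tendsto_map'_iff.mp hlim) (hlog.congr' ?_)
  filter_upwards [Ioo_mem_nhdsLT (show (0 : ℝ) < 1 by norm_num)] with r hr
  have hzr : ‖z * r‖ < 1 := by
    rw [norm_mul, hz, one_mul, Complex.norm_real, Real.norm_of_nonneg hr.1.le]; exact hr.2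
  rw [← (Complex.hasSum_taylorSeries_neg_log hzr).tsum_eq]
  refine tsum_congr fun n ↦ ?_
  simp only [mul_pow]; ring

/-- The value of the sine zeta function at `s = 1`: the Fourier series of the sawtooth. -/
lemma sinZeta_one {a : ℝ} (ha0 : 0 < a) (ha1 : a < 1) :
    HurwitzZeta.sinZeta a 1 = ((Real.pi * (1 / 2 - a) : ℝ) : ℂ) := by
  have hpi := Real.pi_pos
  have ha : (a : UnitAddCircle) ≠ 0 := by
    intro h
    obtain ⟨m, hm⟩ := (AddCircle.coe_eq_zero_iff 1).mp h
    simp only [zsmul_eq_mul, mul_one] at hm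
    rw [← hm] at ha0 ha1
    norm_cast at ha0 ha1
    omega
  have key : 1 - Complex.exp (2 * Real.pi * Complex.I * a) =
      ((2 * Real.sin (Real.pi * a) : ℝ) : ℂ) * (Complex.cos ((Real.pi * a - Real.pi / 2 : ℝ) : ℂ) +
        Complex.sin ((Real.pi * a - Real.pi / 2 : ℝ) : ℂ) * Complex.I) := by
    rw [← Complex.ofReal_cos, ← Complex.ofReal_sin, Real.cos_sub_pi_div_two,
      Real.sin_sub_pi_div_two,
      show (2 * Real.pi * Complex.I * a : ℂ) = ((2 * (Real.pi * a) : ℝ) : ℂ) * Complex.I by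
        push_cast; ring, Complex.exp_mul_I, ← Complex.ofReal_cos, ← Complex.ofReal_sin,
      Real.cos_two_mul, Real.sin_two_mul]
    have h : ((Real.sin (Real.pi * a) : ℂ)) ^ 2 + (Real.cos (Real.pi * a) : ℂ) ^ 2 = 1 :=
      mod_cast Real.sin_sq_add_cos_sq (Real.pi * a)
    generalize Real.sin (Real.pi * a) = x at h ⊢
    generalize Real.cos (Real.pi * a) = y at h ⊢
    push_cast
    linear_combination (-2) * h
  have hsin : 0 < Real.sin (Real.pi * a) :=
    Real.sin_pos_of_pos_of_lt_pi (by positivity) (by nlinarith)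
  have harg : (1 - Complex.exp (2 * Real.pi * Complex.I * a)).arg = Real.pi * a - Real.pi / 2 := by
    rw [key]
    exact Complex.arg_mul_cos_add_sin_mul_I (by positivity) ⟨by nlinarith, by nlinarith⟩
  have hconj : 1 - Complex.exp (2 * Real.pi * Complex.I * (-a : ℝ)) =
      (starRingEnd ℂ) (1 - Complex.exp (2 * Real.pi * Complex.I * a)) := by
    rw [map_sub, map_one, ← Complex.exp_conj]
    simp [Complex.conj_ofNat]
  have hna : ((-a : ℝ) : UnitAddCircle) ≠ 0 := by simpa using ha
  rw [HurwitzZeta.sinZeta_eq, ← AddCircle.coe_neg, expZeta_one ha, expZeta_one hna, hconj,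
    Complex.log_conj _ (by rw [harg]; nlinarith)]
  have hsub := Complex.sub_conj (Complex.log (1 - Complex.exp (2 * Real.pi * Complex.I * a)))
  rw [Complex.log_im, harg] at hsub
  rw [show ∀ x y : ℂ, -x - -y = -(x - y) by intros; ring, hsub]
  field_simp
  push_cast
  ring

/-- The Hurwitz zeta function at `s = 0` (odd part). -/
lemma hurwitzZetaOdd_apply_zero {a : ℝ} (ha0 : 0 < a) (ha1 : a < 1) :
    HurwitzZeta.hurwitzZetaOdd a 0 = ((1 / 2 - a : ℝ) : ℂ) := by
  have h := HurwitzZeta.hurwitzZetaOdd_one_sub (a : UnitAddCircle) (s := 1) (fun n h ↦ by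
    have h1 : (1 : ℝ) = -n := by exact_mod_cast h
    have h2 : (0 : ℝ) ≤ n := n.cast_nonneg
    linarith)
  rw [sub_self] at h
  rw [h, sinZeta_one ha0 ha1, Complex.Gamma_one, mul_one (Real.pi : ℂ), Complex.sin_pi_div_two,
    Complex.cpow_neg_one]
  have : (Real.pi : ℂ) ≠ 0 := by exact_mod_cast Real.pi_ne_zero
  push_cast
  field_simp

namespace DirichletCharacter

/-- The value at `s = 0` of the `L`-function of an odd character. -/
lemma LFunction_apply_zero_of_odd {N : ℕ} [NeZero N] {χ : DirichletCharacter ℂ N} (hχ : χ.Odd) :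
    LFunction χ 0 = ∑ j : ZMod N, χ j * ((1 / 2 - j.val / N : ℝ) : ℂ) := by
  have hN : (0 : ℝ) < N := Nat.cast_pos.mpr (NeZero.pos N)
  rw [LFunction, ZMod.LFunction_def_odd hχ.to_fun, neg_zero, Complex.cpow_zero, one_mul]
  refine sum_congr rfl fun j _ ↦ ?_
  rcases eq_or_ne j 0 with rfl | hj
  · have : χ 0 = 0 := by
      have := hχ.to_fun 0
      rw [neg_zero] at this
      exact self_eq_neg.mp this
    rw [this, zero_mul, zero_mul]
  · rw [ZMod.toAddCircle_apply, hurwitzZetaOdd_apply_zero]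
    · have := Nat.pos_of_ne_zero ((ZMod.val_ne_zero j).mpr hj)
      positivity
    · rw [div_lt_one hN]
      exact_mod_cast ZMod.val_lt j

lemma Odd.inv {N : ℕ} {χ : DirichletCharacter ℂ N} (hχ : χ.Odd) : χ⁻¹.Odd := by
  have h : χ (-1) = -1 := hχ
  have h1 : (-1 : ZMod N) * -1 = 1 := by ring
  rw [DirichletCharacter.Odd, MulChar.inv_apply_eq_inv, h, Ring.inverse_eq_inv']
  norm_num

lemma Odd.ne_one {N : ℕ} {χ : DirichletCharacter ℂ N} (hχ : χ.Odd) : χ ≠ 1 := by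
  rintro rfl
  have h : (1 : DirichletCharacter ℂ N) (-1) = -1 := hχ
  rw [MulChar.one_apply isUnit_one.neg] at h
  norm_num at h

/-- The `L`-function of a primitive odd character does not vanish at `s = 0`. -/
lemma IsPrimitive.LFunction_apply_zero_ne_zero {N : ℕ} [NeZero N] {χ : DirichletCharacter ℂ N}
    (hp : χ.IsPrimitive) (hχ : χ.Odd) : LFunction χ 0 ≠ 0 := by
  intro h0
  have hN : N ≠ 1 := fun h ↦ hχ.ne_one (level_one' _ h)
  rw [LFunction_eq_completed_div_gammaFactor χ 0 (.inr hN), hχ.gammaFactor_def, zero_add,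
    Complex.Gammaℝ_one, div_one] at h0
  have hp' : χ⁻¹.IsPrimitive := by rw [isPrimitive_def, conductor_inv]; exact hp
  have hfe := hp'.completedLFunction_one_sub 0
  rw [inv_inv, h0, mul_zero, sub_zero] at hfe
  refine LFunction_apply_one_ne_zero hχ.inv.ne_one ?_
  rw [LFunction_eq_completed_div_gammaFactor _ 1 (.inl one_ne_zero), hfe, zero_div]

lemma Odd.exists_primitiveCharacter_eq_one {n : ℕ} [NeZero n] {χ : DirichletCharacter ℂ n}
    (hχ : χ.Odd) (h0 : LFunction χ 0 = 0) :
    ∃ p ∈ n.primeFactors, χ.primitiveCharacter p = 1 := by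
  have : NeZero χ.conductor := ⟨χ.conductor_ne_zero⟩
  have hodd : χ.primitiveCharacter.Odd := by
    have h1 := primitiveCharacter_apply_of_isCoprime χ (a := -1) isCoprime_one_left.neg_left
    have h2 : χ (-1) = -1 := hχ
    push_cast at h1
    rw [DirichletCharacter.Odd, h1, h2]
  rw [← χ.changeLevel_primitiveCharacter,
    LFunction_changeLevel _ _ (.inl hodd.ne_one)] at h0
  have h1 := (mul_eq_zero.mp h0).resolve_left
    ((primitiveCharacter_isPrimitive χ).LFunction_apply_zero_ne_zero hodd)
  obtain ⟨p, hp, hp0⟩ := prod_eq_zero_iff.mp h1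
  refine ⟨p, hp, ?_⟩
  rw [neg_zero, Complex.cpow_zero, mul_one, sub_eq_zero] at hp0
  exact hp0.symm

open scoped Classical in
/-- Orthogonality of odd characters, as a mean square. -/
lemma sum_odd_norm_sq {n : ℕ} [NeZero n] {ι : Type*} [Fintype ι] (u : ι → (ZMod n)ˣ) :
    ∑ χ : DirichletCharacter ℂ n with χ.Odd, ‖∑ i, χ (u i)‖ ^ 2 =
      n.totient / 2 * ∑ i, ∑ j, ((if u i = u j then 1 else 0) - if u i = -u j then 1 else 0 : ℝ) := by
  have hind (χ : DirichletCharacter ℂ n) (z : ℂ) :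
      (if χ.Odd then z else 0) = (1 - χ (-1)) / 2 * z := by
    rcases χ.even_or_odd with h | h
    · have h1 : χ (-1) = 1 := h
      rw [if_neg h.not_odd, h1]; simp
    · have h1 : χ (-1) = -1 := h
      rw [if_pos h, h1]; ring
  have hterm (χ : DirichletCharacter ℂ n) : (1 - χ (-1)) / 2 * ((‖∑ i, χ (u i)‖ ^ 2 : ℝ) : ℂ) =
      ∑ i, ∑ j, (χ (u i : ZMod n)⁻¹ * χ (u j) - χ (u i : ZMod n)⁻¹ * χ ((-u j : (ZMod n)ˣ))) / 2 := by
    rw [Complex.ofReal_pow, ← Complex.conj_mul', map_sum, sum_mul_sum, mul_sum]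
    refine sum_congr rfl fun i _ ↦ ?_
    rw [mul_sum]
    refine sum_congr rfl fun j _ ↦ ?_
    have h1 : (starRingEnd ℂ) (χ (u i)) = χ (u i : ZMod n)⁻¹ := by
      rw [starRingEnd_apply, MulChar.star_apply', MulChar.inv_apply, ZMod.inv_coe_unit, Ring.inverse_unit]
    rw [h1, Units.val_neg, ← neg_one_mul (u j : ZMod n), map_mul]
    ring
  rw [← Complex.ofReal_inj, sum_filter, Complex.ofReal_sum]
  simp_rw [apply_ite Complex.ofReal, Complex.ofReal_zero, hind, hterm]
  push_cast
  rw [sum_comm, mul_sum]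
  refine sum_congr rfl fun i _ ↦ ?_
  rw [sum_comm, mul_sum]
  refine sum_congr rfl fun j _ ↦ ?_
  rw [← sum_div, sum_sub_distrib, sum_char_inv_mul_char_eq ℂ (u i).isUnit,
    sum_char_inv_mul_char_eq ℂ (u i).isUnit]
  simp only [← Units.val_neg, Units.val_inj]
  split_ifs <;> simp <;> ring

open scoped Classical in
/-- A bound for the number of odd characters trivial at a given unit. -/
lemma card_odd_apply_eq_one_le {m : ℕ} [NeZero m] (v : (ZMod m)ˣ) :
    2 * orderOf v * #{χ : DirichletCharacter ℂ m | χ.Odd ∧ χ v = 1} ≤ m.totient := by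
  set r := orderOf v with hr
  have hr0 : 0 < r := orderOf_pos v
  have h := sum_odd_norm_sq (fun i : Fin r ↦ v ^ (i : ℕ))
  set S : Finset (DirichletCharacter ℂ m) := {χ | χ.Odd ∧ χ v = 1} with hS
  have hlow : (#S : ℝ) * r ^ 2 ≤
      ∑ χ : DirichletCharacter ℂ m with χ.Odd, ‖∑ i : Fin r, χ ((v ^ (i : ℕ) : (ZMod m)ˣ))‖ ^ 2 := by
    have hsub : S ⊆ ({χ | χ.Odd} : Finset (DirichletCharacter ℂ m)) := fun χ hχ ↦ by
      simp only [hS, mem_filter] at hχ ⊢; tauto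
    refine le_trans (le_of_eq ?_)
      (sum_le_sum_of_subset_of_nonneg hsub fun _ _ _ ↦ by positivity)
    rw [← nsmul_eq_mul, ← sum_const]
    refine sum_congr rfl fun χ hχ ↦ ?_
    have hv : χ v = 1 := (mem_filter.mp hχ).2.2
    simp [hv]
  have hup : ∑ i : Fin r, ∑ j : Fin r, ((if v ^ (i : ℕ) = v ^ (j : ℕ) then 1 else 0) -
      if v ^ (i : ℕ) = -v ^ (j : ℕ) then 1 else 0 : ℝ) ≤ r := by
    calc _ ≤ ∑ i : Fin r, ∑ j : Fin r, (if i = j then 1 else 0 : ℝ) := by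
          refine sum_le_sum fun i _ ↦ sum_le_sum fun j _ ↦ ?_
          have hij : v ^ (i : ℕ) = v ^ (j : ℕ) ↔ i = j :=
            ⟨fun h ↦ Fin.ext (pow_injOn_Iio_orderOf i.2 j.2 h), fun h ↦ by rw [h]⟩
          simp only [hij]
          have : (0 : ℝ) ≤ if v ^ (i : ℕ) = -v ^ (j : ℕ) then 1 else 0 := by positivity
          linarith
      _ = r := by simp
  rw [h] at hlow
  have h2 : (#S : ℝ) * r ^ 2 ≤ m.totient / 2 * r :=
    hlow.trans (mul_le_mul_of_nonneg_left hup (by positivity))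
  have hr1 : (0 : ℝ) < r := by exact_mod_cast hr0
  have h3 : (#S : ℝ) * r ≤ m.totient / 2 := le_of_mul_le_mul_right (by linarith [h2]) hr1
  have h4 : (2 * r * #S : ℝ) ≤ m.totient := by linarith
  exact_mod_cast h4

open scoped Classical in
/-- A bound for the number of odd characters whose primitive character is trivial at a prime
dividing the level. -/
lemma card_odd_primitiveCharacter_eq_one_le {n p : ℕ} [NeZero n] (hp : p.Prime) (hpn : p ∣ n) :
    2 * ((p - 1) * Nat.log p n) *
      #{χ : DirichletCharacter ℂ n | χ.Odd ∧ χ.primitiveCharacter p = 1} ≤ n.totient := by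
  have : Fact p.Prime := ⟨hp⟩
  have hn : n ≠ 0 := NeZero.ne n
  set k := n.factorization p with hk
  set m := n / p ^ k with hm
  have : NeZero m := ⟨(Nat.ordCompl_pos p hn).ne'⟩
  have hcop : p.Coprime m := Nat.coprime_ordCompl hp hn
  have hnm : p ^ k * m = n := Nat.ordProj_mul_ordCompl_eq_self n p
  have hk1 : 1 ≤ k := (hp.dvd_iff_one_le_factorization hn).mp hpn
  set v := ZMod.unitOfCoprime p hcop with hv
  set r := orderOf v with hr
  have hr0 : 0 < r := orderOf_pos v
  have hcard : #{χ : DirichletCharacter ℂ n | χ.Odd ∧ χ.primitiveCharacter p = 1} ≤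
      #{χ : DirichletCharacter ℂ m | χ.Odd ∧ χ v = 1} := by
    refine (card_le_card fun χ hχ ↦ ?_).trans
      (card_image_le (f := changeLevel (R := ℂ) (Nat.ordCompl_dvd n p)))
    obtain ⟨-, hodd, h1⟩ := mem_filter.mp hχ
    rw [← mem_subgroupOfPrimitiveMapToOne_iff] at h1
    obtain ⟨ψ, hψ, rfl⟩ := h1
    refine mem_image.mpr ⟨ψ, mem_filter.mpr ⟨mem_univ _, ?_, ?_⟩, rfl⟩
    · have h2 := changeLevel_eq_cast_of_dvd' ψ (Nat.ordCompl_dvd n p) (a := -1)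
        isCoprime_one_left.neg_left
      push_cast at h2
      have h3 : changeLevel (Nat.ordCompl_dvd n p) ψ (-1) = -1 := hodd
      rw [h3] at h2
      exact h2.symm
    · exact (mem_annihilator_iff.mp hψ) _ rfl
  have hmlt : m < p ^ r := by
    have h1 : ((p ^ r : ℕ) : ZMod m) = (1 : ℕ) := by
      have := congrArg Units.val (pow_orderOf_eq_one v)
      rw [Units.val_pow_eq_pow_val, hv, ZMod.coe_unitOfCoprime, Units.val_one] at this
      push_cast
      exact this
    have hlt : 1 < p ^ r := Nat.one_lt_pow hr0.ne' hp.one_lt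
    have h2 : m ∣ p ^ r - 1 :=
      (Nat.modEq_iff_dvd' hlt.le).mp ((ZMod.natCast_eq_natCast_iff _ _ _).mp h1).symm
    have := Nat.le_of_dvd (by omega) h2
    omega
  have hlog : Nat.log p n ≤ r + k - 1 := by
    have : Nat.log p n < r + k := Nat.log_lt_of_lt_pow hn (by
      rw [← hnm, mul_comm, pow_add]
      exact Nat.mul_lt_mul_of_pos_right hmlt (pow_pos hp.pos k))
    omega
  have hpk : k ≤ p ^ (k - 1) := by
    have := Nat.lt_pow_self (n := k - 1) hp.one_lt
    omega
  have hlog2 : Nat.log p n ≤ p ^ (k - 1) * r := by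
    obtain ⟨c, hc⟩ := Nat.exists_eq_add_of_le hpk
    obtain ⟨r', hr'⟩ := Nat.exists_eq_add_of_le hr0
    obtain ⟨k', hk'⟩ := Nat.exists_eq_add_of_le hk1
    rw [hc]
    refine hlog.trans ?_
    rw [hr', hk']
    have : 1 + r' + (1 + k') - 1 = 1 + r' + k' := by omega
    rw [this]
    simp only [Nat.zero_add, Nat.succ_eq_add_one]
    nlinarith [Nat.zero_le (k' * r'), Nat.zero_le (c * r')]
  have htot : n.totient = p ^ (k - 1) * (p - 1) * m.totient := by
    rw [← hnm, Nat.totient_mul (hcop.pow_left k), Nat.totient_prime_pow hp hk1]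
  rw [htot]
  calc _ ≤ 2 * ((p - 1) * (p ^ (k - 1) * r)) * #{χ : DirichletCharacter ℂ m | χ.Odd ∧ χ v = 1} := by
        gcongr
    _ = p ^ (k - 1) * (p - 1) *
        (2 * r * #{χ : DirichletCharacter ℂ m | χ.Odd ∧ χ v = 1}) := by ring
    _ ≤ _ := Nat.mul_le_mul_left _ (card_odd_apply_eq_one_le v)

end DirichletCharacter

lemma inv_natLog_le {p n : ℕ} (hp : 2 ≤ p) (hpn : p ≤ n) :
    1 / (Nat.log p n : ℝ) ≤ 2 * Real.log p / Real.log n := by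
  have ht : 1 ≤ Nat.log p n := Nat.log_pos hp hpn
  have hlt : n < p ^ (2 * Nat.log p n) :=
    (Nat.lt_pow_succ_log_self hp n).trans_le (Nat.pow_le_pow_right (by omega) (by omega))
  have hn : 0 < Real.log n := Real.log_pos (by exact_mod_cast (by omega : 1 < n))
  have hlog : Real.log n ≤ 2 * Nat.log p n * Real.log p := by
    have h1 : (n : ℝ) ≤ (p : ℝ) ^ (2 * Nat.log p n) := by exact_mod_cast hlt.le
    have h2 := Real.log_le_log (by exact_mod_cast (by omega : 0 < n)) h1
    rw [Real.log_pow] at h2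
    exact_mod_cast h2
  have ht' : (0 : ℝ) < Nat.log p n := by exact_mod_cast ht
  rw [div_le_div_iff₀ ht' hn]
  linarith

lemma sum_log_primeFactors_le {n : ℕ} (hn : n ≠ 0) :
    ∑ p ∈ n.primeFactors, Real.log p ≤ Real.log n := by
  rw [← Real.log_prod fun p hp ↦ by
    exact_mod_cast (Nat.prime_of_mem_primeFactors hp).ne_zero]
  have h1 := Nat.le_of_dvd (Nat.pos_of_ne_zero hn) (Nat.prod_primeFactors_dvd n)
  have h0 : 0 < ∏ p ∈ n.primeFactors, p := prod_pos fun p hp ↦ Nat.pos_of_mem_primeFactors hp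
  rw [← Nat.cast_prod]
  exact Real.log_le_log (Nat.cast_pos.mpr h0) (Nat.cast_le.mpr h1)

lemma sum_primeFactors_inv_lt {n : ℕ} (h6 : n.Coprime 6) (hN : 10 ^ 20 < n) :
    ∑ p ∈ n.primeFactors, 1 / (((p - 1) * Nat.log p n : ℕ) : ℝ) < 1 / 4 := by
  have hn0 : n ≠ 0 := by omega
  have hlogn : 0 < Real.log n := Real.log_pos (by exact_mod_cast (by omega : 1 < n))
  have hterm : ∀ p ∈ n.primeFactors, 1 / (((p - 1) * Nat.log p n : ℕ) : ℝ) ≤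
      1 / 5 / Real.log n * Real.log p + ((if p = 5 then 1 / 112 else 0) +
        if p = 7 then 1 / 138 else 0) := by
    intro p hp
    have hpp := Nat.prime_of_mem_primeFactors hp
    have hpn := Nat.dvd_of_mem_primeFactors hp
    have hlogp : 0 ≤ Real.log p := Real.log_natCast_nonneg p
    have hpos : 0 ≤ 1 / 5 / Real.log n * Real.log p := by positivity
    have hc : p.Coprime 6 := h6.coprime_dvd_left hpn
    by_cases hp11 : 11 ≤ p
    · have h1 := inv_natLog_le hpp.two_le (Nat.le_of_dvd (by omega) hpn)
      have h2 : (10 : ℝ) ≤ ((p - 1 : ℕ) : ℝ) := by exact_mod_cast (by omega : 10 ≤ p - 1)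
      rw [if_neg (by omega), if_neg (by omega), add_zero, add_zero, Nat.cast_mul,
        ← one_div_mul_one_div]
      calc 1 / ((p - 1 : ℕ) : ℝ) * (1 / (Nat.log p n : ℝ))
          ≤ 1 / 10 * (2 * Real.log p / Real.log n) := by
            gcongr
        _ = 1 / 5 / Real.log n * Real.log p := by ring
    · have h57 : p = 5 ∨ p = 7 := by
        have := hpp.two_le
        interval_cases p <;> revert hpp hc <;> decide
      rcases h57 with rfl | rfl
      · have h28 : 28 ≤ Nat.log 5 n := Nat.le_log_of_pow_le (by norm_num) (by omega)
        have h3 : (1 : ℝ) / (((5 - 1) * Nat.log 5 n : ℕ) : ℝ) ≤ 1 / 112 := by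
          apply one_div_le_one_div_of_le (by norm_num)
          exact_mod_cast (by omega : 112 ≤ (5 - 1) * Nat.log 5 n)
        simp only [if_true]
        norm_num at h3 hpos ⊢
        linarith
      · have h23 : 23 ≤ Nat.log 7 n := Nat.le_log_of_pow_le (by norm_num) (by omega)
        have h3 : (1 : ℝ) / (((7 - 1) * Nat.log 7 n : ℕ) : ℝ) ≤ 1 / 138 := by
          apply one_div_le_one_div_of_le (by norm_num)
          exact_mod_cast (by omega : 138 ≤ (7 - 1) * Nat.log 7 n)
        simp only [if_true]
        norm_num at h3 hpos ⊢
        linarith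
  have hite (q : ℕ) (c : ℝ) (hc : 0 ≤ c) : ∑ p ∈ n.primeFactors, (if p = q then c else 0) ≤ c := by
    rw [sum_ite_eq']
    split_ifs <;> linarith
  have hmain : 1 / 5 / Real.log n * ∑ p ∈ n.primeFactors, Real.log p ≤ 1 / 5 := by
    calc _ ≤ 1 / 5 / Real.log n * Real.log n := by
          gcongr
          exact sum_log_primeFactors_le hn0
      _ = 1 / 5 := by field_simp
  have h := sum_le_sum hterm
  rw [sum_add_distrib, sum_add_distrib, ← mul_sum] at h
  have h5 := hite 5 (1 / 112) (by norm_num)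
  have h7 := hite 7 (1 / 138) (by norm_num)
  linarith

open scoped Classical in
/-- Few odd characters modulo `n` have an `L`-function vanishing at `s = 0`. -/
lemma card_odd_LFunction_apply_zero_lt {n : ℕ} [NeZero n] (h6 : n.Coprime 6) (hN : 10 ^ 20 < n) :
    (8 : ℝ) * #{χ : DirichletCharacter ℂ n | χ.Odd ∧ χ.LFunction 0 = 0} < n.totient := by
  have htot : (0 : ℝ) < n.totient := by exact_mod_cast Nat.totient_pos.mpr (NeZero.pos n)
  have hsub : ({χ | χ.Odd ∧ χ.LFunction 0 = 0} : Finset (DirichletCharacter ℂ n)) ⊆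
      n.primeFactors.biUnion fun p ↦ {χ | χ.Odd ∧ χ.primitiveCharacter p = 1} := by
    intro χ hχ
    obtain ⟨-, hodd, h0⟩ := mem_filter.mp hχ
    obtain ⟨p, hp, h1⟩ := hodd.exists_primitiveCharacter_eq_one h0
    exact mem_biUnion.mpr ⟨p, hp, mem_filter.mpr ⟨mem_univ _, hodd, h1⟩⟩
  have hcard : (#{χ : DirichletCharacter ℂ n | χ.Odd ∧ χ.LFunction 0 = 0} : ℝ) ≤
      ∑ p ∈ n.primeFactors,
        (#{χ : DirichletCharacter ℂ n | χ.Odd ∧ χ.primitiveCharacter p = 1} : ℝ) := by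
    exact_mod_cast (card_le_card hsub).trans card_biUnion_le
  have hterm : ∀ p ∈ n.primeFactors,
      (#{χ : DirichletCharacter ℂ n | χ.Odd ∧ χ.primitiveCharacter p = 1} : ℝ) ≤
        n.totient / 2 * (1 / (((p - 1) * Nat.log p n : ℕ) : ℝ)) := by
    intro p hp
    have hpp := Nat.prime_of_mem_primeFactors hp
    have hpn := Nat.dvd_of_mem_primeFactors hp
    have h := DirichletCharacter.card_odd_primitiveCharacter_eq_one_le hpp hpn
    have hlog : 0 < Nat.log p n := Nat.log_pos hpp.one_lt (Nat.le_of_dvd (NeZero.pos n) hpn)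
    have hpos : (0 : ℝ) < ((p - 1) * Nat.log p n : ℕ) := by
      exact_mod_cast Nat.mul_pos (Nat.sub_pos_of_lt hpp.one_lt) hlog
    have h' : (2 : ℝ) * ((p - 1) * Nat.log p n : ℕ) *
        #{χ : DirichletCharacter ℂ n | χ.Odd ∧ χ.primitiveCharacter p = 1} ≤ n.totient := by
      exact_mod_cast h
    rw [mul_one_div, le_div_iff₀ hpos]
    linarith
  have h := hcard.trans (sum_le_sum hterm)
  rw [← mul_sum] at h
  have := mul_lt_mul_of_pos_left (sum_primeFactors_inv_lt h6 hN) (half_pos htot)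
  linarith

/-- If all dilates of a sequence of four units have residues with sum `2 * n`, the sums of values
of an odd character whose `L`-function does not vanish at `s = 0` are zero. -/
lemma sum_character_eq_zero_of_sum_val_eq {n : ℕ} [NeZero n] (u : Fin 4 → (ZMod n)ˣ)
    (hu : ∀ g : (ZMod n)ˣ, ∑ i, ((g * u i : (ZMod n)ˣ) : ZMod n).val = 2 * n)
    {χ : DirichletCharacter ℂ n} (hχ : χ.Odd) (h0 : χ.LFunction 0 ≠ 0) :
    ∑ i, χ ((u i)⁻¹ : (ZMod n)ˣ) = 0 := by
  have hn : (n : ℝ) ≠ 0 := by exact_mod_cast NeZero.ne n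
  let B : ZMod n → ℂ := fun j ↦ ((1 / 2 - j.val / n : ℝ) : ℂ)
  have hL : χ.LFunction 0 = ∑ j, χ j * B j := DirichletCharacter.LFunction_apply_zero_of_odd hχ
  have hi (i : Fin 4) : χ ((u i)⁻¹ : (ZMod n)ˣ) * χ.LFunction 0 = ∑ j, χ j * B (j * u i) := by
    rw [hL, mul_sum]
    refine (Fintype.sum_equiv (Units.mulRight (u i)) _ _ fun j ↦ ?_).symm
    change χ j * B (j * u i) = χ ((u i)⁻¹ : (ZMod n)ˣ) * (χ (j * u i) * B (j * u i))
    rw [← mul_assoc, ← map_mul, mul_comm j (u i : ZMod n), Units.inv_mul_cancel_left]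
  have hsum : (∑ i, χ ((u i)⁻¹ : (ZMod n)ˣ)) * χ.LFunction 0 = 0 := by
    rw [sum_mul, sum_congr rfl fun i _ ↦ hi i, sum_comm]
    refine sum_eq_zero fun j _ ↦ ?_
    rw [← mul_sum]
    by_cases hj : IsUnit j
    · obtain ⟨g, rfl⟩ := hj
      have h1 : (∑ i, (((g * u i : ZMod n)).val : ℝ)) = 2 * n := by
        exact_mod_cast hu g
      have h2 : ∑ i, B (g * u i) = 0 := by
        rw [← Complex.ofReal_sum, sum_sub_distrib,
          ← sum_div univ (fun i ↦ (((g * u i : ZMod n)).val : ℝ)), h1]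
        rw [mul_div_assoc, div_self hn]
        simp
        norm_num
      rw [h2, mul_zero]
    · rw [χ.map_nonunit hj, zero_mul]
  exact (mul_eq_zero.mp hsum).resolve_right h0

open scoped Classical in
lemma exists_sum_val_ne {n : ℕ} [NeZero n] (h6 : n.Coprime 6) (hN : 10 ^ 20 < n)
    (u : Fin 4 → (ZMod n)ˣ) (hu : ∀ i j, u i ≠ -u j) :
    ∃ g : (ZMod n)ˣ, ∑ i, ((g * u i : (ZMod n)ˣ) : ZMod n).val ≠ 2 * n := by
  by_contra! hall
  have hP := DirichletCharacter.sum_odd_norm_sq fun i ↦ (u i)⁻¹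
  have hlow : (4 : ℝ) ≤ ∑ i, ∑ j, ((if (u i)⁻¹ = (u j)⁻¹ then 1 else 0) -
      if (u i)⁻¹ = -(u j)⁻¹ then 1 else 0 : ℝ) := by
    calc (4 : ℝ) = ∑ i : Fin 4, ∑ j : Fin 4, if i = j then (1 : ℝ) else 0 := by simp
      _ ≤ _ := by
        refine sum_le_sum fun i _ ↦ sum_le_sum fun j _ ↦ ?_
        rw [if_neg (c := (u i)⁻¹ = -(u j)⁻¹), sub_zero]
        · by_cases h : i = j
          · simp [h]
          · rw [if_neg h]; positivity
        · intro h
          apply hu i j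
          rw [← inv_inj, h, inv_neg]
  have hup : ∑ χ : DirichletCharacter ℂ n with χ.Odd, ‖∑ i, χ ((u i)⁻¹ : (ZMod n)ˣ)‖ ^ 2 ≤
      16 * #{χ : DirichletCharacter ℂ n | χ.Odd ∧ χ.LFunction 0 = 0} := by
    rw [← filter_filter, card_filter, Nat.cast_sum, mul_sum]
    refine sum_le_sum fun χ hχ ↦ ?_
    have hodd := (mem_filter.mp hχ).2
    by_cases h0 : χ.LFunction 0 = 0
    · have : ‖∑ i, χ ((u i)⁻¹ : (ZMod n)ˣ)‖ ≤ 4 := by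
        refine (norm_sum_le _ _).trans ((sum_le_sum fun i _ ↦ χ.norm_le_one _).trans ?_)
        simp
      rw [if_pos h0]
      push_cast
      nlinarith [norm_nonneg (∑ i, χ ((u i)⁻¹ : (ZMod n)ˣ))]
    · rw [sum_character_eq_zero_of_sum_val_eq u hall hodd h0, if_neg h0]
      simp
  have hlt := card_odd_LFunction_apply_zero_lt h6 hN
  rw [hP] at hup
  have := mul_le_mul_of_nonneg_left hlow (by positivity : (0 : ℝ) ≤ n.totient / 2)
  linarith

lemma seqIndex_eq_one_of_exists {n k : ℕ} (hn : 1 < n) [NeZero k] {a : Fin k → ZMod n}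
    (ha0 : ∑ j, a j = 0) (ha : ∀ j, IsUnit (a j))
    (hg : ∃ g : (ZMod n)ˣ, ∑ j, ((g : ZMod n) * a j).val = n) : seqIndex n a = 1 := by
  have hn0 : n ≠ 0 := by omega
  have : NeZero n := ⟨hn0⟩
  have : Fact (1 < n) := ⟨hn⟩
  rw [seqIndex, dif_neg hn0, div_eq_one_iff_eq (by exact_mod_cast hn0)]
  apply le_antisymm
  · obtain ⟨g, hg⟩ := hg
    refine (inf'_le _ (mem_univ g)).trans (le_of_eq ?_)
    exact_mod_cast hg
  · refine le_inf' _ _ fun g _ ↦ ?_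
    have hdvd : n ∣ ∑ j, ((g : ZMod n) * a j).val := by
      rw [← ZMod.natCast_eq_zero_iff]
      push_cast
      simp only [ZMod.natCast_val, ZMod.cast_id', id_eq]
      rw [← mul_sum, ha0, mul_zero]
    have hpos : 0 < ∑ j, ((g : ZMod n) * a j).val := by
      refine sum_pos (fun j _ ↦ Nat.pos_of_ne_zero ?_) univ_nonempty
      rw [ZMod.val_ne_zero]
      exact (g.isUnit.mul (ha j)).ne_zero
    exact_mod_cast Nat.le_of_dvd hpos hdvd

theorem stmt0 (n : ℕ) (h6 : Nat.gcd n 6 = 1) (hN : 10 ^ 20 < n)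
    (a : Fin 4 → ZMod n) (hmin : IsMinZeroSum n a)
    (hcop : ∀ i, Nat.gcd n (a i).val = 1) :
    seqIndex n a = 1 := by
  have hn1 : 1 < n := by omega
  have : NeZero n := ⟨by omega⟩
  have : Fact (1 < n) := ⟨hn1⟩
  have hunit (i : Fin 4) : IsUnit (a i) := by
    rw [← ZMod.natCast_zmod_val (a i), ZMod.isUnit_iff_coprime]
    exact Nat.Coprime.symm (hcop i)
  choose u hu using hunit
  have hneg (i j : Fin 4) : u i ≠ -u j := by
    intro h
    have h' : a i + a j = 0 := by
      rw [← hu i, ← hu j, h, Units.val_neg, neg_add_cancel]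
    rcases eq_or_ne i j with rfl | hij
    · have h2 : IsUnit (2 : ZMod n) := by
        have := (ZMod.isUnit_iff_coprime 2 n).mpr
          (Nat.Coprime.symm (Nat.Coprime.coprime_dvd_right (by norm_num) h6))
        exact_mod_cast this
      rw [← two_mul, h2.mul_right_eq_zero, ← hu i] at h'
      exact (u i).ne_zero h'
    · refine hmin.2 {i, j} (insert_nonempty _ _) (fun h ↦ ?_) (by rw [sum_pair hij, h'])
      have h1 := congrArg card h
      rw [card_pair hij] at h1
      simp at h1
  obtain ⟨g, hg⟩ := exists_sum_val_ne h6 hN u hneg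
  have hcoe (g : (ZMod n)ˣ) (i : Fin 4) : ((g * u i : (ZMod n)ˣ) : ZMod n) = g * a i := by
    rw [Units.val_mul, hu]
  simp only [hcoe] at hg
  refine seqIndex_eq_one_of_exists hn1 hmin.1 (fun j ↦ ⟨u j, hu j⟩) ?_
  have hne (i : Fin 4) : (g : ZMod n) * a i ≠ 0 := by
    rw [← hcoe]; exact Units.ne_zero _
  have hdvd : n ∣ ∑ j, ((g : ZMod n) * a j).val := by
    rw [← ZMod.natCast_eq_zero_iff]
    push_cast
    simp only [ZMod.natCast_val, ZMod.cast_id', id_eq]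
    rw [← mul_sum, hmin.1, mul_zero]
  obtain ⟨c, hc⟩ := hdvd
  have hlt (i : Fin 4) : ((g : ZMod n) * a i).val < n := ZMod.val_lt _
  have hpos (i : Fin 4) : 0 < ((g : ZMod n) * a i).val :=
    Nat.pos_of_ne_zero ((ZMod.val_ne_zero _).mpr (hne i))
  have hc4 : c < 4 := by
    refine lt_of_mul_lt_mul_left (a := n) ?_ (Nat.zero_le n)
    rw [← hc, Fin.sum_univ_four]
    have h0 := hlt 0; have h1 := hlt 1; have h2 := hlt 2; have h3 := hlt 3
    omega
  have hc0 : c ≠ 0 := by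
    rintro rfl
    rw [Fin.sum_univ_four] at hc
    have h0 := hpos 0
    omega
  have hc2 : c ≠ 2 := by
    rintro rfl
    exact hg (by rw [hc, mul_comm])
  obtain rfl | rfl : c = 1 ∨ c = 3 := by omega
  · exact ⟨g, by rw [hc, mul_one]⟩
  · refine ⟨-g, ?_⟩
    have hval (i : Fin 4) : (((-g : (ZMod n)ˣ) : ZMod n) * a i).val =
        n - ((g : ZMod n) * a i).val := by
      rw [Units.val_neg, neg_mul, ZMod.neg_val, if_neg (hne i)]
    simp only [hval]
    rw [Fin.sum_univ_four] at hc ⊢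
    have h0 := hlt 0; have h1 := hlt 1; have h2 := hlt 2; have h3 := hlt 3
    omega
end

section
/- There exist absolute constants c > 0 and N such that the following holds. Let n be a positive integer with n > N and gcd(n,6)=1, and let a, b be integers coprime to n. Suppose that for every pair (x,y) ∈ {(1,a),(1,b),(a,b)} neither x + y ≡ 0 (mod n) nor x − y ≡ 0 (mod n), and that at least one of the three pairs (x,y) satisfies none of the congruences x + 3y ≡ 0, x − 3y ≡ 0, 3x + y ≡ 0, 3x − y ≡ 0 (mod n). Then the number of g ∈ (ℤ/n)^* such that (g)_n/n ∈ [0,1/2], (a g)_n/n ∈ [0,1/2], and (b g)_n/n ∈ [0,1/2] is at least c·φ(n). -/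
open Finset in
theorem sum_primitiveRoots_eq_moebius {n : ℕ} (hn : 0 < n) :
    ∑ ζ ∈ primitiveRoots n ℂ, ζ = (ArithmeticFunction.moebius n : ℂ) := by
  have key : ∀ n > 0, ∑ i ∈ n.divisors, (∑ ζ ∈ primitiveRoots i ℂ, ζ)
      = (fun n : ℕ => if n = 1 then (1 : ℂ) else 0) n := by
    intro n hn
    have : NeZero n := ⟨hn.ne'⟩
    have hζ := Complex.isPrimitiveRoot_exp n hn.ne'
    rw [← Finset.sum_biUnion, ← IsPrimitiveRoot.nthRoots_one_eq_biUnion_primitiveRoots]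
    · have : Polynomial.nthRootsFinset n (1 : ℂ)
          = (range n).image (fun i => Complex.exp (2 * Real.pi * Complex.I / n) ^ i) := by
        symm
        apply Finset.eq_of_subset_of_card_le
        · intro x hx
          obtain ⟨i, -, rfl⟩ := Finset.mem_image.1 hx
          rw [Polynomial.mem_nthRootsFinset hn, ← pow_mul, mul_comm i, pow_mul,
            hζ.pow_eq_one, one_pow]
        · rw [hζ.card_nthRootsFinset, Finset.card_image_of_injOn, Finset.card_range]
          intro i hi j hj h
          exact hζ.pow_inj (by simpa using hi) (by simpa using hj) h
      rw [this, Finset.sum_image]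
      · by_cases h1 : n = 1
        · subst h1; simp
        · simp only [h1, if_false]
          exact hζ.geom_sum_eq_zero (by omega)
      · intro i hi j hj h
        exact hζ.pow_inj (by simpa using hi) (by simpa using hj) h
    · intro i _ j _ hij
      exact IsPrimitiveRoot.disjoint hij
  have := ArithmeticFunction.sum_eq_iff_sum_mul_moebius_eq.1 key n hn
  rw [← this, Finset.sum_eq_single (n, 1)]
  · simp
  · rintro ⟨a, b⟩ hx hne
    have hb : b ≠ 1 := by
      rintro rfl
      simp at hx
      exact hne (by simp [hx.1])
    simp [hb]
  · intro h
    simp [hn.ne'] at h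

theorem norm_sum_units_stdAddChar_le {n : ℕ} [NeZero n] :
    ‖∑ g : (ZMod n)ˣ, ZMod.stdAddChar (g : ZMod n)‖ ≤ 1 := by
  have hn : 0 < n := Nat.pos_of_ne_zero (NeZero.ne n)
  have himg : Finset.univ.image (fun g : (ZMod n)ˣ => (ZMod.stdAddChar (g : ZMod n) : ℂ))
      = primitiveRoots n ℂ := by
    apply Finset.eq_of_subset_of_card_le
    · intro x hx
      obtain ⟨g, -, rfl⟩ := Finset.mem_image.1 hx
      rw [mem_primitiveRoots hn]
      have h := (Complex.isPrimitiveRoot_exp n hn.ne').pow_of_coprime _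
        ((ZMod.isUnit_iff_coprime (g : ZMod n).val n).1 (by simp))
      convert h using 1
      rw [← ZMod.natCast_zmod_val (g : ZMod n), ← Int.cast_natCast, ZMod.stdAddChar_coe,
        ← Complex.exp_nat_mul]
      simp
      ring_nf
    · rw [show (fun g : (ZMod n)ˣ => (ZMod.stdAddChar (g : ZMod n) : ℂ))
          = ZMod.stdAddChar ∘ Units.val
        from rfl, Finset.card_image_of_injective _
        (ZMod.injective_stdAddChar.comp Units.val_injective), Finset.card_univ,
        ZMod.card_units_eq_totient, (Complex.isPrimitiveRoot_exp n hn.ne').card_primitiveRoots]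
  have : ∑ g : (ZMod n)ˣ, (ZMod.stdAddChar (g : ZMod n) : ℂ) = ArithmeticFunction.moebius n := by
    rw [← sum_primitiveRoots_eq_moebius hn, ← himg, Finset.sum_image]
    exact fun a _ b _ h => (ZMod.injective_stdAddChar.comp Units.val_injective) h
  rw [this]
  have := @ArithmeticFunction.abs_moebius_le_one n
  rw [Complex.norm_intCast]
  exact_mod_cast this

theorem norm_sum_units_stdAddChar_mul_totient_le {n : ℕ} [NeZero n] (t : ℤ) :
    ‖∑ g : (ZMod n)ˣ, ZMod.stdAddChar ((t : ZMod n) * (g : ZMod n))‖ * (n / Int.gcd n t).totient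
      ≤ n.totient := by
  classical
  have hn : 0 < n := Nat.pos_of_ne_zero (NeZero.ne n)
  have hc : 0 < Int.gcd n t := Int.gcd_pos_of_ne_zero_left _ (by exact_mod_cast hn.ne')
  obtain ⟨c, d, u, hcd⟩ : ∃ c d : ℕ, ∃ u : ℤ, 0 < c ∧ n = c * d ∧ t = c * u ∧
      Int.gcd d u = 1 ∧ n / Int.gcd n t = d := by
    obtain ⟨d, hd⟩ : Int.gcd n t ∣ n := by exact_mod_cast Int.gcd_dvd_left (n : ℤ) t
    obtain ⟨u, hu⟩ := Int.gcd_dvd_right (n : ℤ) t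
    refine ⟨Int.gcd n t, d, u, hc, hd, hu, ?_, ?_⟩
    · have h1 := Int.gcd_mul_left (Int.gcd n t) d u
      have h2 : (Int.gcd n t : ℤ) * d = n := by exact_mod_cast hd.symm
      rw [h2, ← hu] at h1
      simp only [Int.natAbs_natCast] at h1
      nlinarith
    · conv_lhs => rw [hd]
      rw [← hd]
      exact Nat.div_eq_of_eq_mul_right hc hd
  obtain ⟨hc0, hnd, htu, hdu, hdiv⟩ := hcd
  rw [hdiv]
  have hd0 : d ≠ 0 := by rintro rfl; omega
  have : NeZero d := ⟨hd0⟩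
  have hdn : d ∣ n := ⟨c, by rw [hnd, mul_comm]⟩
  have huu : IsUnit (u : ZMod d) := by
    rw [ZMod.coe_int_isUnit_iff_isCoprime]
    exact (Int.isCoprime_iff_gcd_eq_one).2 (by simpa using hdu)
  obtain ⟨w, hw⟩ := huu
  have h1 : ∀ g : (ZMod n)ˣ, (ZMod.stdAddChar ((t : ZMod n) * (g : ZMod n)) : ℂ)
      = ZMod.stdAddChar ((w * ZMod.unitsMap hdn g : (ZMod d)ˣ) : ZMod d) := by
    intro g
    have e1 : ((t : ZMod n) * (g : ZMod n)) = ((t * ((g : ZMod n).val : ℤ) : ℤ) : ZMod n) := by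
      push_cast; simp
    have e2 : ((w * ZMod.unitsMap hdn g : (ZMod d)ˣ) : ZMod d)
        = ((u * ((g : ZMod n).val : ℤ) : ℤ) : ZMod d) := by
      rw [Units.val_mul, hw, ZMod.unitsMap_val]
      push_cast; simp
    rw [e1, e2, ZMod.stdAddChar_coe, ZMod.stdAddChar_coe]
    congr 1
    have : (c : ℂ) ≠ 0 := by exact_mod_cast hc0.ne'
    have : (d : ℂ) ≠ 0 := by exact_mod_cast hd0
    have hn' : (n : ℂ) = c * d := by exact_mod_cast hnd
    rw [htu, hn']; push_cast
    field_simp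
  have hsurj := ZMod.unitsMap_surjective hdn
  have hfib : ∀ v : (ZMod d)ˣ, (Finset.univ.filter (fun g => ZMod.unitsMap hdn g = v)).card
      = (Finset.univ.filter (fun g => ZMod.unitsMap hdn g = 1)).card := fun v =>
    MonoidHom.card_fiber_eq_of_mem_range (ZMod.unitsMap hdn) (hsurj v) (hsurj 1)
  set m := (Finset.univ.filter (fun g => ZMod.unitsMap hdn g = 1)).card with hm
  have hsum : ∀ F : (ZMod d)ˣ → ℂ, ∑ g, F (ZMod.unitsMap hdn g) = m * ∑ v, F v := by
    intro F
    rw [← Finset.sum_fiberwise (s := Finset.univ) (g := ZMod.unitsMap hdn), Finset.mul_sum]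
    refine Finset.sum_congr rfl fun v _ => ?_
    rw [Finset.sum_congr rfl (g := fun _ => F v)]
    · rw [Finset.sum_const, hfib v, nsmul_eq_mul]
    · intro g hg
      rw [(Finset.mem_filter.1 hg).2]
  have hcard : (n.totient : ℝ) = m * d.totient := by
    have := hsum (fun _ => 1)
    simp only [Finset.sum_const, Finset.card_univ, ZMod.card_units_eq_totient, nsmul_eq_mul,
      mul_one] at this
    exact_mod_cast this
  rw [Finset.sum_congr rfl (fun g _ => h1 g),
    hsum (fun v => ZMod.stdAddChar ((w * v : (ZMod d)ˣ) : ZMod d)),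
    (Group.mulLeft_bijective w).sum_comp (fun v : (ZMod d)ˣ => (ZMod.stdAddChar (v : ZMod d) : ℂ)),
    hcard, norm_mul, Complex.norm_natCast]
  have := norm_sum_units_stdAddChar_le (n := d)
  have h3 : (0:ℝ) ≤ m * d.totient := by positivity
  nlinarith

theorem le_totient_sq_of_odd {d : ℕ} (hd : Odd d) : d ≤ d.totient ^ 2 := by
  induction d using Nat.recOnPosPrimePosCoprime with
  | prime_pow p k hp hk =>
    have hp3 : 3 ≤ p := by
      have : p ≠ 2 := by
        rintro rfl
        exact (Nat.not_even_iff_odd.2 hd) ((Nat.even_pow.2 ⟨even_two, hk.ne'⟩))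
      have := hp.two_le
      omega
    rw [Nat.totient_prime_pow hp hk, mul_pow]
    obtain ⟨q, rfl⟩ : ∃ q, p = q + 3 := ⟨p - 3, by omega⟩
    obtain ⟨j, rfl⟩ : ∃ j, k = j + 1 := ⟨k - 1, by omega⟩
    simp only [Nat.add_sub_cancel, pow_succ]
    have h1 : 1 ≤ (q + 3) ^ j := Nat.one_le_pow _ _ (by omega)
    have h2 : q + 3 ≤ (q + 3 - 1) ^ 2 := by
      rw [show q + 3 - 1 = q + 2 by omega]; nlinarith
    calc (q + 3) ^ j * (q + 3) ≤ ((q + 3) ^ j * (q + 3) ^ j) * (q + 3 - 1) ^ 2 :=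
          Nat.mul_le_mul (Nat.le_mul_of_pos_left _ h1) h2
      _ = _ := by ring
  | zero => simp
  | one => simp
  | coprime a b ha hb hab iha ihb =>
    rw [Nat.totient_mul hab, mul_pow]
    exact Nat.mul_le_mul (iha (Nat.odd_mul.1 hd).1) (ihb (Nat.odd_mul.1 hd).2)

theorem four_le_totient_of_coprime_six {d : ℕ} (h1 : d ≠ 1) (hd : d.Coprime 6) :
    4 ≤ d.totient := by
  obtain ⟨p, hp, hpd⟩ := Nat.exists_prime_and_dvd h1
  have hp6 : p.Coprime 6 := hd.coprime_dvd_left hpd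
  have h5 : 5 ≤ p := by
    by_contra! h
    have := hp.two_le
    interval_cases p <;> revert hp6 <;> decide
  have hd0 : 0 < d := by
    rcases Nat.eq_zero_or_pos d with rfl | h
    · revert hd; decide
    · exact h
  have := Nat.le_of_dvd (Nat.totient_pos.2 hd0) (Nat.totient_dvd_of_dvd hpd)
  rw [Nat.totient_prime hp] at this
  omega

open Filter Topology MeasureTheory
open scoped BigOperators ComplexConjugate

theorem norm_expect_stdAddChar_le {n : ℕ} [NeZero n] (t : ℤ) :
    ‖𝔼 g : (ZMod n)ˣ, (ZMod.stdAddChar ((t : ZMod n) * (g : ZMod n)) : ℂ)‖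
      ≤ 1 / (n / Int.gcd n t).totient := by
  have hn : 0 < n := Nat.pos_of_ne_zero (NeZero.ne n)
  have hc : 0 < Int.gcd n t := Int.gcd_pos_of_ne_zero_left _ (by exact_mod_cast hn.ne')
  have hd : 0 < n / Int.gcd n t :=
    Nat.div_pos (Nat.le_of_dvd hn (by exact_mod_cast Int.gcd_dvd_left (n : ℤ) t)) hc
  have h1 : (0 : ℝ) < (n / Int.gcd n t).totient := by exact_mod_cast Nat.totient_pos.2 hd
  have h2 : (0 : ℝ) < n.totient := by exact_mod_cast Nat.totient_pos.2 hn
  rw [Fintype.expect_eq_sum_div_card, ZMod.card_units_eq_totient, norm_div, Complex.norm_natCast,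
    div_le_div_iff₀ h2 h1, one_mul]
  exact norm_sum_units_stdAddChar_mul_totient_le t

theorem tendsto_expect_stdAddChar {k : ℤ} (hk : k ≠ 0) :
    Tendsto (fun m : ℕ => 𝔼 g : (ZMod (2 * m + 1))ˣ,
      (ZMod.stdAddChar ((k : ZMod (2 * m + 1)) * (g : ZMod (2 * m + 1))) : ℂ)) atTop (𝓝 0) := by
  have hlim : Tendsto (fun m : ℕ => √((k.natAbs : ℝ) / ((2 * m + 1 : ℕ) : ℝ))) atTop (𝓝 0) := by
    rw [← Real.sqrt_zero]
    refine (Real.continuous_sqrt.tendsto 0).comp ?_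
    refine tendsto_const_nhds.div_atTop ?_
    refine tendsto_natCast_atTop_atTop.comp ?_
    exact tendsto_atTop_mono (fun m => show m ≤ 2 * m + 1 by omega) tendsto_id
  refine squeeze_zero_norm (fun m => ?_) hlim
  refine (norm_expect_stdAddChar_le k).trans ?_
  set n := 2 * m + 1 with hn
  set c := Int.gcd n k with hc
  have hcn : c ∣ n := by exact_mod_cast Int.gcd_dvd_left (n : ℤ) k
  have hck : c ≤ k.natAbs := Int.gcd_le_natAbs_right _ hk
  obtain ⟨d, hd⟩ := hcn
  have hc0 : 0 < c := Nat.pos_of_ne_zero (by rintro h; rw [h] at hd; omega)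
  have hd0 : 0 < d := Nat.pos_of_ne_zero (by rintro h; rw [h] at hd; omega)
  have hnd : n / c = d := Nat.div_eq_of_eq_mul_right hc0 hd
  have hodd : Odd d := by
    have : Odd (c * d) := hd ▸ ⟨m, hn⟩
    exact (Nat.odd_mul.1 this).2
  rw [hnd]
  apply Real.le_sqrt_of_sq_le
  have h1 : (0 : ℝ) < d.totient := by exact_mod_cast Nat.totient_pos.2 hd0
  have h2 : (0 : ℝ) < n := by exact_mod_cast (by omega : 0 < n)
  rw [div_pow, one_pow, div_le_div_iff₀ (by positivity) h2, one_mul]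
  have h3 : n ≤ k.natAbs * d.totient ^ 2 := by
    rw [hd]
    exact Nat.mul_le_mul hck (le_totient_sq_of_odd hodd)
  exact_mod_cast h3

theorem fourier_toAddCircle {n : ℕ} [NeZero n] (k : ℤ) (j : ZMod n) :
    fourier k (ZMod.toAddCircle j) = (ZMod.stdAddChar ((k : ZMod n) * j) : ℂ) := by
  rw [fourier_apply, ← map_zsmul, zsmul_eq_mul]
  rfl

theorem integral_fourier_eq_zero {k : ℤ} (hk : k ≠ 0) :
    ∫ x : UnitAddCircle, fourier k x = 0 :=
  integral_eq_zero_of_add_right_eq_neg (g := (((1 : ℝ) / 2 / k : ℝ) : UnitAddCircle))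
    (fourier_add_half_inv_index hk one_pos)

theorem tendsto_expect_units (F : C(UnitAddCircle, ℂ)) :
    Tendsto (fun m : ℕ => 𝔼 g : (ZMod (2 * m + 1))ˣ, F (ZMod.toAddCircle (g : ZMod (2 * m + 1))))
      atTop (𝓝 (∫ x, F x)) := by
  have hFint : ∀ F : C(UnitAddCircle, ℂ), Integrable F volume := fun F =>
    F.continuous.integrable_of_hasCompactSupport (HasCompactSupport.of_compactSpace _)
  have hvol : (volume : Measure UnitAddCircle).real Set.univ = 1 := by
    rw [measureReal_def, UnitAddCircle.measure_univ, ENNReal.toReal_one]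
  have hspan : ∀ P ∈ Submodule.span ℂ (Set.range (fourier : ℤ → C(UnitAddCircle, ℂ))),
      Tendsto (fun m : ℕ => 𝔼 g : (ZMod (2 * m + 1))ˣ,
        P (ZMod.toAddCircle (g : ZMod (2 * m + 1)))) atTop (𝓝 (∫ x, P x)) := by
    intro P hP
    induction hP using Submodule.span_induction with
    | mem P hP =>
      obtain ⟨k, rfl⟩ := hP
      simp only [fourier_toAddCircle]
      by_cases hk : k = 0
      · subst hk
        simp [hvol]
      · rw [integral_fourier_eq_zero hk]
        exact tendsto_expect_stdAddChar hk
    | zero => simp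
    | add P Q _ _ hP hQ =>
      simp only [ContinuousMap.add_apply, Finset.expect_add_distrib]
      rw [integral_add (hFint P) (hFint Q)]
      exact hP.add hQ
    | smul a P _ hP =>
      simp only [ContinuousMap.smul_apply, smul_eq_mul, ← Finset.mul_expect]
      rw [integral_const_mul]
      exact hP.const_mul a
  rw [Metric.tendsto_atTop]
  intro ε hε
  have hF : F ∈ (Submodule.span ℂ (Set.range
      (fourier : ℤ → C(UnitAddCircle, ℂ)))).topologicalClosure := by
    rw [span_fourier_closure_eq_top]; trivial
  obtain ⟨P, hP, hFP⟩ := Metric.mem_closure_iff.1 hF (ε / 3) (by positivity)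
  obtain ⟨N, hN⟩ := Metric.tendsto_atTop.1 (hspan P hP) (ε / 3) (by positivity)
  refine ⟨N, fun m hm => ?_⟩
  have hpt : ∀ x, ‖F x - P x‖ ≤ ε / 3 := fun x => by
    rw [← dist_eq_norm]; exact (ContinuousMap.dist_apply_le_dist x).trans hFP.le
  have h1 : ‖(𝔼 g : (ZMod (2 * m + 1))ˣ, F (ZMod.toAddCircle (g : ZMod (2 * m + 1))))
      - 𝔼 g : (ZMod (2 * m + 1))ˣ, P (ZMod.toAddCircle (g : ZMod (2 * m + 1)))‖ ≤ ε / 3 := by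
    rw [← Finset.expect_sub_distrib]
    refine (RCLike.norm_expect_le (K := ℂ)).trans ?_
    exact Finset.expect_le Finset.univ_nonempty (fun g _ => hpt _)
  have h2 : ‖(∫ x, F x) - ∫ x, P x‖ ≤ ε / 3 := by
    rw [← integral_sub (hFint F) (hFint P)]
    have := norm_integral_le_of_norm_le_const (μ := (volume : Measure UnitAddCircle))
      (ae_of_all _ hpt)
    simpa [hvol] using this
  have h3 := hN m hm
  rw [dist_eq_norm] at h3 ⊢
  set A := 𝔼 g : (ZMod (2 * m + 1))ˣ, F (ZMod.toAddCircle (g : ZMod (2 * m + 1)))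
  set B := 𝔼 g : (ZMod (2 * m + 1))ˣ, P (ZMod.toAddCircle (g : ZMod (2 * m + 1)))
  set I := ∫ x, F x
  set J := ∫ x, P x
  calc ‖A - I‖ = ‖(A - B) + (B - J) - (I - J)‖ := by ring_nf
    _ ≤ ‖A - B‖ + ‖B - J‖ + ‖I - J‖ := (norm_sub_le _ _).trans (by gcongr; exact norm_add_le _ _)
    _ < ε := by linarith

theorem continuous_sign_mul_of_eq_zero {X : Type*} [TopologicalSpace X] {f g : X → ℝ}
    (hf : Continuous f) (hg : Continuous g) (h : ∀ x, f x = 0 → g x = 0) :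
    Continuous fun x => Real.sign (f x) * g x := by
  rw [continuous_iff_continuousAt]
  intro x
  rcases lt_trichotomy (f x) 0 with hx | hx | hx
  · have : (fun y => Real.sign (f y) * g y) =ᶠ[𝓝 x] fun y => -g y := by
      filter_upwards [hf.continuousAt.eventually (gt_mem_nhds hx)] with y hy
      rw [Real.sign_of_neg hy]; ring
    exact (hg.neg.continuousAt).congr this.symm
  · rw [ContinuousAt, h x hx, mul_zero]
    refine squeeze_zero_norm (a := fun y => ‖g y‖) (fun y => ?_) ?_
    · rw [norm_mul]
      refine mul_le_of_le_one_left (norm_nonneg _) ?_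
      rcases Real.sign_apply_eq (f y) with h | h | h <;> simp [h]
    · have := hg.norm.tendsto x
      rwa [h x hx, norm_zero] at this
  · have : (fun y => Real.sign (f y) * g y) =ᶠ[𝓝 x] g := by
      filter_upwards [hf.continuousAt.eventually (lt_mem_nhds hx)] with y hy
      rw [Real.sign_of_pos hy, one_mul]
    exact (hg.continuousAt).congr this.symm

theorem fourier_coe_im (k : ℤ) (x : ℝ) :
    (fourier k (x : UnitAddCircle)).im = Real.sin (2 * Real.pi * k * x) := by
  rw [fourier_coe_apply, ← Complex.exp_ofReal_mul_I_im]
  congr 2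
  push_cast
  ring

/-- The product of the square wave `sign (sin (2πx))` with `sin (2πkx)`. -/
noncomputable def squareWaveMulSin (k : ℤ) : C(UnitAddCircle, ℝ) where
  toFun x := Real.sign (fourier 1 x).im * (fourier k x).im
  continuous_toFun := by
    refine continuous_sign_mul_of_eq_zero (by fun_prop) (by fun_prop) fun x hx => ?_
    induction x using QuotientAddGroup.induction_on with
    | H x =>
      change (fourier 1 (x : UnitAddCircle)).im = 0 at hx
      rw [fourier_coe_im] at hx ⊢
      obtain ⟨j, hj⟩ := Real.sin_eq_zero_iff.1 hx
      rw [show 2 * Real.pi * k * x = ((k * j : ℤ) : ℝ) * Real.pi by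
        push_cast at hj ⊢; linear_combination (-(k : ℝ)) * hj]
      exact Real.sin_int_mul_pi _

theorem integral_squareWaveMulSin {k : ℤ} (hk : Odd k) :
    ∫ x, squareWaveMulSin k x = 2 / (Real.pi * k) := by
  have hπ := Real.pi_pos
  have hk0 : (k : ℝ) ≠ 0 := by
    rintro h
    have : k = 0 := by exact_mod_cast h
    subst this
    simp at hk
  have hc : (2 * Real.pi * k) ≠ 0 := by positivity
  have hcos : Real.cos (2 * Real.pi * k * (1 / 2)) = -1 := by
    obtain ⟨j, rfl⟩ := hk
    rw [show 2 * Real.pi * ((2 * j + 1 : ℤ) : ℝ) * (1 / 2) = Real.pi + j * (2 * Real.pi) by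
      push_cast; ring, Real.cos_add_int_mul_two_pi, Real.cos_pi]
  have hcos1 : Real.cos (2 * Real.pi * k * 1) = 1 := by
    rw [show 2 * Real.pi * (k : ℝ) * 1 = k * (2 * Real.pi) by ring,
      Real.cos_int_mul_two_pi]
  have hsin : Real.sin (2 * Real.pi * k * (1 / 2)) = 0 := by
    rw [show 2 * Real.pi * (k : ℝ) * (1 / 2) = k * Real.pi by ring, Real.sin_int_mul_pi]
  have hsin1 : Real.sin (2 * Real.pi * k * 1) = 0 := by
    rw [show 2 * Real.pi * (k : ℝ) * 1 = ((2 * k : ℤ) : ℝ) * Real.pi by push_cast; ring,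
      Real.sin_int_mul_pi]
  have hval : ∀ x : ℝ, squareWaveMulSin k (x : UnitAddCircle)
      = Real.sign (Real.sin (2 * Real.pi * x)) * Real.sin (2 * Real.pi * k * x) := fun x => by
    change Real.sign (fourier 1 (x : UnitAddCircle)).im * (fourier k (x : UnitAddCircle)).im = _
    rw [fourier_coe_im, fourier_coe_im]
    norm_num
  have hcont : Continuous fun x : ℝ => squareWaveMulSin k (x : UnitAddCircle) :=
    (squareWaveMulSin k).continuous.comp (AddCircle.continuous_mk' 1)
  rw [← UnitAddCircle.intervalIntegral_preimage 0, zero_add,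
    ← intervalIntegral.integral_add_adjacent_intervals (b := 1 / 2)
      (hcont.intervalIntegrable _ _) (hcont.intervalIntegrable _ _)]
  have h1 : ∫ x in (0 : ℝ)..(1 / 2), squareWaveMulSin k (x : UnitAddCircle)
      = ∫ x in (0 : ℝ)..(1 / 2), Real.sin (2 * Real.pi * k * x) := by
    refine intervalIntegral.integral_congr fun x hx => ?_
    rw [Set.uIcc_of_le (by norm_num)] at hx
    rw [hval]
    rcases eq_or_lt_of_le hx.1 with rfl | h0
    · simp
    rcases eq_or_lt_of_le hx.2 with rfl | h0'
    · rw [hsin, mul_zero]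
    rw [Real.sign_of_pos, one_mul]
    exact Real.sin_pos_of_pos_of_lt_pi (by positivity) (by nlinarith)
  have h2 : ∫ x in (1 / 2 : ℝ)..1, squareWaveMulSin k (x : UnitAddCircle)
      = ∫ x in (1 / 2 : ℝ)..1, -Real.sin (2 * Real.pi * k * x) := by
    refine intervalIntegral.integral_congr fun x hx => ?_
    rw [Set.uIcc_of_le (by norm_num)] at hx
    rw [hval]
    rcases eq_or_lt_of_le hx.1 with rfl | h0
    · rw [hsin]; simp
    rcases eq_or_lt_of_le hx.2 with rfl | h0'
    · rw [hsin1]; simp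
    rw [Real.sign_of_neg, neg_one_mul]
    rw [← Real.sin_sub_two_pi]
    exact Real.sin_neg_of_neg_of_neg_pi_lt (by nlinarith) (by nlinarith)
  rw [h1, h2, intervalIntegral.integral_neg, intervalIntegral.integral_comp_mul_left _ hc,
    intervalIntegral.integral_comp_mul_left _ hc, integral_sin, integral_sin, hcos, hcos1]
  simp only [mul_zero, Real.cos_zero, smul_eq_mul]
  field_simp
  norm_num

/-- The square wave `sign (sin (2πj/n))` on `ℤ/n`. -/
noncomputable def squareWave {n : ℕ} [NeZero n] (j : ZMod n) : ℝ :=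
  Real.sign (ZMod.stdAddChar j : ℂ).im

theorem stdAddChar_neg_eq_conj {n : ℕ} [NeZero n] (j : ZMod n) :
    (ZMod.stdAddChar (-j) : ℂ) = conj (ZMod.stdAddChar j : ℂ) := by
  rw [AddChar.map_neg_eq_conj]

theorem squareWave_neg {n : ℕ} [NeZero n] (j : ZMod n) : squareWave (-j) = -squareWave j := by
  rw [squareWave, stdAddChar_neg_eq_conj, Complex.conj_im, Real.sign_neg, squareWave]

theorem abs_squareWave_le_one {n : ℕ} [NeZero n] (j : ZMod n) : |squareWave j| ≤ 1 := by
  rcases Real.sign_apply_eq (ZMod.stdAddChar j : ℂ).im with h | h | h <;> simp [squareWave, h]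

theorem tendsto_expect_squareWave_mul_im {k : ℤ} (hk : Odd k) :
    Tendsto (fun m : ℕ => 𝔼 g : (ZMod (2 * m + 1))ˣ, squareWave (g : ZMod (2 * m + 1)) *
      (ZMod.stdAddChar ((k : ZMod (2 * m + 1)) * (g : ZMod (2 * m + 1))) : ℂ).im)
      atTop (𝓝 (2 / (Real.pi * k))) := by
  have h := tendsto_expect_units
    ⟨fun x => (squareWaveMulSin k x : ℂ), by fun_prop⟩
  simp only [ContinuousMap.coe_mk] at h
  rw [integral_complex_ofReal, integral_squareWaveMulSin hk] at h
  have h' := (Complex.continuous_re.tendsto _).comp h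
  simp only [Complex.ofReal_re] at h'
  refine h'.congr fun m => ?_
  rw [Function.comp_apply, ← Complex.ofReal_expect, Complex.ofReal_re]
  refine Finset.expect_congr rfl fun g _ => ?_
  change Real.sign (fourier 1 _).im * (fourier k _).im = _
  rw [fourier_toAddCircle, fourier_toAddCircle]
  simp [squareWave]

theorem expect_squareWave_mul_conj {n : ℕ} [NeZero n] (k : ℤ) :
    𝔼 g : (ZMod n)ˣ, (squareWave (g : ZMod n) : ℂ) *
      conj (ZMod.stdAddChar ((k : ZMod n) * (g : ZMod n)) : ℂ)
    = -Complex.I * ((𝔼 g : (ZMod n)ˣ, squareWave (g : ZMod n) *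
      (ZMod.stdAddChar ((k : ZMod n) * (g : ZMod n)) : ℂ).im : ℝ) : ℂ) := by
  set F : (ZMod n)ˣ → ℂ := fun g => (squareWave (g : ZMod n) : ℂ) *
      conj (ZMod.stdAddChar ((k : ZMod n) * (g : ZMod n)) : ℂ) with hF
  have h1 : 𝔼 g, F g = 𝔼 g, F (-g) :=
    Fintype.expect_equiv (Equiv.neg _) _ _ (fun g => by simp)
  have h2 : ∀ g, F g + F (-g) = 2 * (-Complex.I * ((squareWave (g : ZMod n) *
      (ZMod.stdAddChar ((k : ZMod n) * (g : ZMod n)) : ℂ).im : ℝ) : ℂ)) := fun g => by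
    simp only [hF, Units.val_neg, squareWave_neg, mul_neg, stdAddChar_neg_eq_conj,
      Complex.conj_conj]
    apply Complex.ext <;> simp
    ring
  have h3 : 𝔼 g, F g + 𝔼 g, F (-g) = 2 * (-Complex.I * ((𝔼 g : (ZMod n)ˣ,
      squareWave (g : ZMod n) *
      (ZMod.stdAddChar ((k : ZMod n) * (g : ZMod n)) : ℂ).im : ℝ) : ℂ)) := by
    rw [← Finset.expect_add_distrib, Finset.expect_congr rfl fun g _ => h2 g,
      ← Finset.mul_expect, ← Finset.mul_expect]
    congr 2
    exact (Complex.ofReal_expect _ _).symm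
  rw [← h1, ← two_mul] at h3
  exact mul_left_cancel₀ two_ne_zero h3

/-- `-i` times this number is the `k`-th Fourier coefficient of the square wave, `k` odd. -/
noncomputable def squareCoeff (k : ℤ) : ℝ := 2 / (Real.pi * k)

/-- The part of the Fourier series of the square wave with frequencies in `B`. -/
noncomputable def partialWave (B : Finset ℤ) {n : ℕ} [NeZero n] (j : ZMod n) : ℂ :=
  ∑ k ∈ B, (-Complex.I * squareCoeff k) * ZMod.stdAddChar ((k : ZMod n) * j)

theorem norm_sub_sq_ofReal (s : ℝ) (hs : |s| ≤ 1) (z : ℂ) :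
    ‖(s : ℂ) - z‖ ^ 2 ≤ 1 - 2 * ((s : ℂ) * conj z).re + (z * conj z).re := by
  have h1 : ‖(s : ℂ) - z‖ ^ 2 = s ^ 2 - 2 * ((s : ℂ) * conj z).re + (z * conj z).re := by
    rw [← Complex.normSq_eq_norm_sq, Complex.normSq_apply]
    simp
    ring
  rw [h1]
  have := (sq_le_one_iff_abs_le_one s).2 hs
  linarith

theorem stdAddChar_mul_conj {n : ℕ} [NeZero n] (k l : ℤ) (j : ZMod n) :
    (ZMod.stdAddChar ((k : ZMod n) * j) : ℂ) * conj (ZMod.stdAddChar ((l : ZMod n) * j) : ℂ)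
      = ZMod.stdAddChar (((k - l : ℤ) : ZMod n) * j) := by
  rw [← stdAddChar_neg_eq_conj, ← AddChar.map_add_eq_mul]
  congr 1
  push_cast
  ring

theorem tendsto_expect_squareWave_mul_conj_partialWave {B : Finset ℤ} (hB : ∀ k ∈ B, Odd k) :
    Tendsto (fun m : ℕ => 𝔼 g : (ZMod (2 * m + 1))ˣ, (squareWave (g : ZMod (2 * m + 1)) : ℂ) *
      conj (partialWave B (g : ZMod (2 * m + 1)))) atTop
      (𝓝 ((∑ k ∈ B, squareCoeff k ^ 2 : ℝ) : ℂ)) := by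
  have h : ∀ m : ℕ, 𝔼 g : (ZMod (2 * m + 1))ˣ, (squareWave (g : ZMod (2 * m + 1)) : ℂ) *
      conj (partialWave B (g : ZMod (2 * m + 1)))
      = ((∑ k ∈ B, squareCoeff k * 𝔼 g : (ZMod (2 * m + 1))ˣ,
        squareWave (g : ZMod (2 * m + 1)) *
        (ZMod.stdAddChar ((k : ZMod (2 * m + 1)) * (g : ZMod (2 * m + 1))) : ℂ).im : ℝ) : ℂ) := by
    intro m
    simp only [partialWave, map_sum, Finset.mul_sum, Finset.expect_sum_comm]
    rw [Complex.ofReal_sum]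
    refine Finset.sum_congr rfl fun k _ => ?_
    have := expect_squareWave_mul_conj (n := 2 * m + 1) k
    rw [Complex.ofReal_mul, ← mul_right_inj' Complex.I_ne_zero, mul_left_comm,
      show Complex.I * ((𝔼 g : (ZMod (2 * m + 1))ˣ, squareWave (g : ZMod (2 * m + 1)) *
        (ZMod.stdAddChar ((k : ZMod (2 * m + 1)) * (g : ZMod (2 * m + 1))) : ℂ).im : ℝ) : ℂ)
        = -𝔼 g : (ZMod (2 * m + 1))ˣ, (squareWave (g : ZMod (2 * m + 1)) : ℂ) *
          conj (ZMod.stdAddChar ((k : ZMod (2 * m + 1)) * (g : ZMod (2 * m + 1))) : ℂ) by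
        rw [this]; ring, ← Finset.expect_neg_distrib, Finset.mul_expect, Finset.mul_expect]
    refine Finset.expect_congr rfl fun g _ => ?_
    simp only [map_mul, map_neg, Complex.conj_I, Complex.conj_ofReal]
    linear_combination (squareWave (g : ZMod (2 * m + 1)) : ℂ) * squareCoeff k *
      conj (ZMod.stdAddChar ((k : ZMod (2 * m + 1)) * (g : ZMod (2 * m + 1))) : ℂ) *
      Complex.I_mul_I
  simp only [h]
  refine (Complex.continuous_ofReal.tendsto _).comp ?_
  refine tendsto_finsetSum _ fun k hk => ?_
  rw [sq]
  exact (tendsto_expect_squareWave_mul_im (hB k hk)).const_mul _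

theorem tendsto_expect_partialWave_mul_conj (B : Finset ℤ) :
    Tendsto (fun m : ℕ => 𝔼 g : (ZMod (2 * m + 1))ˣ, partialWave B (g : ZMod (2 * m + 1)) *
      conj (partialWave B (g : ZMod (2 * m + 1)))) atTop
      (𝓝 ((∑ k ∈ B, squareCoeff k ^ 2 : ℝ) : ℂ)) := by
  have h : ∀ m : ℕ, 𝔼 g : (ZMod (2 * m + 1))ˣ, partialWave B (g : ZMod (2 * m + 1)) *
      conj (partialWave B (g : ZMod (2 * m + 1)))
      = ∑ k ∈ B, ∑ l ∈ B, (squareCoeff k * squareCoeff l : ℂ) * 𝔼 g : (ZMod (2 * m + 1))ˣ,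
        (ZMod.stdAddChar (((k - l : ℤ) : ZMod (2 * m + 1)) * (g : ZMod (2 * m + 1))) : ℂ) := by
    intro m
    simp only [partialWave, map_sum, Finset.sum_mul_sum, Finset.expect_sum_comm]
    refine Finset.sum_congr rfl fun k _ => Finset.sum_congr rfl fun l _ => ?_
    rw [Finset.mul_expect]
    refine Finset.expect_congr rfl fun g _ => ?_
    rw [← stdAddChar_mul_conj]
    simp only [map_mul, map_neg, Complex.conj_I, Complex.conj_ofReal]
    linear_combination (-(squareCoeff k * squareCoeff l : ℂ) *
      ZMod.stdAddChar ((k : ZMod (2 * m + 1)) * (g : ZMod (2 * m + 1))) *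
      conj (ZMod.stdAddChar ((l : ZMod (2 * m + 1)) * (g : ZMod (2 * m + 1))) : ℂ)) *
      Complex.I_mul_I
  simp only [h]
  rw [Complex.ofReal_sum]
  refine tendsto_finsetSum _ fun k hk => ?_
  have hlim : ((squareCoeff k ^ 2 : ℝ) : ℂ)
      = ∑ l ∈ B, (squareCoeff k * squareCoeff l : ℂ) * if k = l then 1 else 0 := by
    simp [hk, sq]
  rw [hlim]
  refine tendsto_finsetSum _ fun l _ => Tendsto.const_mul _ ?_
  split_ifs with hkl
  · simp [hkl]
  · exact tendsto_expect_stdAddChar (sub_ne_zero.2 hkl)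

theorem eventually_expect_norm_sub_partialWave_sq_le {B : Finset ℤ} (hB : ∀ k ∈ B, Odd k)
    {ε : ℝ} (hε : 1 - ∑ k ∈ B, squareCoeff k ^ 2 < ε) :
    ∀ᶠ m : ℕ in atTop, 𝔼 g : (ZMod (2 * m + 1))ˣ,
      ‖(squareWave (g : ZMod (2 * m + 1)) : ℂ) - partialWave B (g : ZMod (2 * m + 1))‖ ^ 2
        ≤ ε := by
  have h1 := (Complex.continuous_re.tendsto _).comp
    (tendsto_expect_squareWave_mul_conj_partialWave hB)
  have h2 := (Complex.continuous_re.tendsto _).comp (tendsto_expect_partialWave_mul_conj B)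
  have h3 := ((h1.const_mul 2).const_sub 1).add h2
  simp only [Complex.ofReal_re] at h3
  filter_upwards [h3.eventually_le_const (by linarith : _ < ε)] with m hm
  refine le_trans ?_ hm
  simp only [Function.comp_apply, Complex.re_expect, Finset.mul_expect]
  rw [← Fintype.expect_one (ι := (ZMod (2 * m + 1))ˣ) (M := ℝ), ← Finset.expect_sub_distrib,
    ← Finset.expect_add_distrib]
  exact Finset.expect_le_expect fun g _ =>
    norm_sub_sq_ofReal _ (abs_squareWave_le_one _) _

theorem hasSum_one_div_odd_sq :
    HasSum (fun j : ℕ => 1 / ((2 * j + 1 : ℕ) : ℝ) ^ 2) (Real.pi ^ 2 / 8) := by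
  have h := hasSum_zeta_two
  have heven : HasSum (fun j : ℕ => 1 / ((2 * j : ℕ) : ℝ) ^ 2) (1 / 4 * (Real.pi ^ 2 / 6)) := by
    have e : (fun j : ℕ => 1 / ((2 * j : ℕ) : ℝ) ^ 2) = fun j : ℕ => 1 / 4 * (1 / (j : ℝ) ^ 2) := by
      ext j
      push_cast
      rw [mul_pow, one_div_mul_one_div]
      norm_num
    rw [e]
    exact h.mul_left _
  have hodd : Summable (fun j : ℕ => 1 / ((2 * j + 1 : ℕ) : ℝ) ^ 2) :=
    h.summable.comp_injective (i := fun j : ℕ => 2 * j + 1) (fun a b hab => by simpa using hab)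
  have h' := HasSum.even_add_odd (f := fun n : ℕ => 1 / (n : ℝ) ^ 2) heven hodd.hasSum
  have := h.unique h'
  rw [show Real.pi ^ 2 / 8 = ∑' j : ℕ, 1 / ((2 * j + 1 : ℕ) : ℝ) ^ 2 by linarith]
  exact hodd.hasSum

theorem exists_odd_finset_sum_squareCoeff_sq {ε : ℝ} (hε : 0 < ε) :
    ∃ B : Finset ℤ, (∀ k ∈ B, Odd k) ∧ {1, -1, 3, -3} ⊆ B ∧ ∑ k ∈ B, squareCoeff k ^ 2 ≤ 1 ∧
      1 - ∑ k ∈ B, squareCoeff k ^ 2 < ε := by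
  have hπ := Real.pi_pos
  have hsum : HasSum (fun j : ℕ => squareCoeff (2 * j + 1) ^ 2) (1 / 2) := by
    have e : (fun j : ℕ => squareCoeff (2 * j + 1) ^ 2)
        = fun j : ℕ => 4 / Real.pi ^ 2 * (1 / ((2 * j + 1 : ℕ) : ℝ) ^ 2) := by
      ext j
      rw [squareCoeff]
      push_cast
      have : (2 * (j : ℝ) + 1) ≠ 0 := by positivity
      field_simp
      norm_num
    have e' : 4 / Real.pi ^ 2 * (Real.pi ^ 2 / 8) = 1 / 2 := by
      field_simp
      norm_num
    rw [e, ← e']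
    exact hasSum_one_div_odd_sq.mul_left _
  have hlim := hsum.tendsto_sum_nat
  obtain ⟨M, hM, hM2⟩ := ((hlim.eventually_const_lt
    (by linarith : 1 / 2 - ε / 2 < 1 / 2)).and (eventually_ge_atTop 2)).exists
  have hle : ∑ j ∈ Finset.range M, squareCoeff (2 * j + 1) ^ 2 ≤ 1 / 2 :=
    sum_le_hasSum _ (fun _ _ => sq_nonneg _) hsum
  set P := (Finset.range M).image (fun j : ℕ => (2 * j + 1 : ℤ)) with hP
  set Q := (Finset.range M).image (fun j : ℕ => (-(2 * j + 1) : ℤ)) with hQ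
  have hdisj : Disjoint P Q := by
    rw [Finset.disjoint_left]
    intro a ha hb
    simp only [hP, hQ, Finset.mem_image] at ha hb
    omega
  have hPs : ∑ k ∈ P, squareCoeff k ^ 2 = ∑ j ∈ Finset.range M, squareCoeff (2 * j + 1) ^ 2 :=
    Finset.sum_image fun a _ b _ h => by simpa using h
  have hQs : ∑ k ∈ Q, squareCoeff k ^ 2 = ∑ j ∈ Finset.range M, squareCoeff (2 * j + 1) ^ 2 := by
    rw [hQ, Finset.sum_image fun a _ b _ h => by simpa using h]
    refine Finset.sum_congr rfl fun j _ => ?_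
    simp only [squareCoeff]
    push_cast
    rw [mul_neg, div_neg, neg_sq]
  refine ⟨P ∪ Q, fun k hk => ?_, fun k hk => ?_, ?_, ?_⟩
  · simp only [hP, hQ, Finset.mem_union, Finset.mem_image] at hk
    rcases hk with ⟨j, -, rfl⟩ | ⟨j, -, rfl⟩
    · exact ⟨j, rfl⟩
    · exact ⟨-j - 1, by ring⟩
  · simp only [hP, hQ, Finset.mem_union, Finset.mem_image, Finset.mem_range]
    simp only [Finset.mem_insert, Finset.mem_singleton] at hk
    rcases hk with rfl | rfl | rfl | rfl
    · exact Or.inl ⟨0, by omega, by norm_num⟩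
    · exact Or.inr ⟨0, by omega, by norm_num⟩
    · exact Or.inl ⟨1, by omega, by norm_num⟩
    · exact Or.inr ⟨1, by omega, by norm_num⟩
  · rw [Finset.sum_union hdisj, hPs, hQs]; linarith
  · rw [Finset.sum_union hdisj, hPs, hQs]; linarith

/-- An upper bound for the size of the mean of `g ↦ e(tg/n)` over the units modulo `n`. -/
noncomputable def unitMeanBound (n : ℕ) (t : ℤ) : ℝ := 1 / (n / Int.gcd n t).totient

theorem unitMeanBound_nonneg (n : ℕ) (t : ℤ) : 0 ≤ unitMeanBound n t := by
  unfold unitMeanBound; positivity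

theorem div_gcd_pos {n : ℕ} (hn : 0 < n) (t : ℤ) : 0 < n / Int.gcd n t :=
  Nat.div_pos (Nat.le_of_dvd hn (by exact_mod_cast Int.gcd_dvd_left (a := n) (b := t)))
    (Int.gcd_pos_of_ne_zero_left _ (by exact_mod_cast hn.ne'))

theorem div_gcd_dvd (n : ℕ) (t : ℤ) : n / Int.gcd n t ∣ n :=
  Nat.div_dvd_of_dvd (by exact_mod_cast Int.gcd_dvd_left (a := n) (b := t))

theorem dvd_div_gcd_mul (n : ℕ) (t : ℤ) : (n : ℤ) ∣ (n / Int.gcd n t : ℕ) * t := by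
  have h : Int.gcd n t ∣ n := by exact_mod_cast Int.gcd_dvd_left (a := n) (b := t)
  obtain ⟨s, hs⟩ := Int.gcd_dvd_right (a := n) (b := t)
  have e : ((n / Int.gcd n t : ℕ) : ℤ) * Int.gcd n t = n := by
    exact_mod_cast Nat.div_mul_cancel h
  exact ⟨s, by rw [← e, mul_assoc, ← hs, e]⟩

theorem unitMeanBound_le_one {n : ℕ} (hn : 0 < n) (t : ℤ) : unitMeanBound n t ≤ 1 := by
  have h : (1 : ℝ) ≤ (n / Int.gcd n t).totient := by
    exact_mod_cast Nat.totient_pos.2 (div_gcd_pos hn t)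
  exact div_le_one_of_le₀ h (by positivity)

theorem unitMeanBound_le_quarter {n : ℕ} (hn : n.Coprime 6) {t : ℤ} (ht : ¬ (n : ℤ) ∣ t) :
    unitMeanBound n t ≤ 1 / 4 := by
  have h : (4 : ℝ) ≤ (n / Int.gcd n t).totient := by
    refine mod_cast four_le_totient_of_coprime_six (fun h => ht ?_)
      (hn.coprime_dvd_left (div_gcd_dvd n t))
    simpa [h] using dvd_div_gcd_mul n t
  exact one_div_le_one_div_of_le (by norm_num) h

theorem unitMeanBound_le_one_div_of_lt {n D : ℕ} (hn : Odd n) {t : ℤ} (hD : 0 < D)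
    (ht : D ^ 2 < n / Int.gcd n t) : unitMeanBound n t ≤ 1 / D := by
  have h : D ≤ (n / Int.gcd n t).totient :=
    (Nat.pow_le_pow_iff_left two_ne_zero).1
      (ht.le.trans (le_totient_sq_of_odd (Odd.of_dvd_nat hn (div_gcd_dvd n t))))
  exact one_div_le_one_div_of_le (by positivity) (by exact_mod_cast h)

theorem abs_squareCoeff (k : ℤ) : |squareCoeff k| = 2 / (Real.pi * |(k : ℝ)|) := by
  rw [squareCoeff, abs_div, abs_mul, abs_of_pos Real.pi_pos, abs_two]

theorem squareCoeff_sq (k : ℤ) : squareCoeff k ^ 2 = 4 / (Real.pi ^ 2 * (k : ℝ) ^ 2) := by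
  rw [squareCoeff, div_pow, mul_pow]; norm_num

theorem pi_sq_lt : Real.pi ^ 2 < 9.9225 := by
  have := Real.pi_lt_d2
  have := Real.pi_pos
  nlinarith

section CoefficientSums

variable {B : Finset ℤ} {S : Finset (ℤ × ℤ)}

theorem sum_abs_squareCoeff_mul_le_of_natAbs_ne_one (hsub : {1, -1, 3, -3} ⊆ B)
    (hB : ∑ k ∈ B, squareCoeff k ^ 2 ≤ 1) (hBo : ∀ k ∈ B, Odd k) (hS : S ⊆ B ×ˢ B)
    (hprop : ∀ p ∈ S, ∀ q ∈ S, p.1 * q.2 = q.1 * p.2)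
    (h1 : ∀ p ∈ S, p.1.natAbs ≠ 1) (h2 : ∀ p ∈ S, p.2.natAbs ≠ 1)
    {ρ : ℤ × ℤ → ℝ} (hρ : ∀ p ∈ S, ρ p ≤ 1) :
    ∑ p ∈ S, |squareCoeff p.1| * |squareCoeff p.2| * ρ p ≤ 1 / 5 := by
  have hne : ∀ k ∈ B, k ≠ 0 := fun k hk h => by simpa [h] using hBo k hk
  have hC : ∑ k ∈ B \ {1, -1}, squareCoeff k ^ 2 ≤ 1 / 5 := by
    have hs := Finset.sum_sdiff (f := fun k => squareCoeff k ^ 2)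
      (show ({1, -1} : Finset ℤ) ⊆ B from fun k hk => hsub (by simp at hk ⊢; tauto))
    rw [Finset.sum_pair (by norm_num), squareCoeff_sq, squareCoeff_sq] at hs
    have : (0.4 : ℝ) ≤ 4 / Real.pi ^ 2 := by
      rw [le_div_iff₀ (by positivity)]
      linarith [pi_sq_lt]
    push_cast at hs
    norm_num at hs this
    linarith
  have aux : ∀ f : ℤ × ℤ → ℤ, Set.InjOn f S → (∀ p ∈ S, f p ∈ B) → (∀ p ∈ S, (f p).natAbs ≠ 1) →
      ∑ p ∈ S, squareCoeff (f p) ^ 2 ≤ 1 / 5 := by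
    intro f hf hfB hf1
    rw [← Finset.sum_image (f := fun k => squareCoeff k ^ 2) hf]
    refine le_trans (Finset.sum_le_sum_of_subset_of_nonneg ?_ fun _ _ _ => sq_nonneg _) hC
    intro k hk
    obtain ⟨p, hp, rfl⟩ := Finset.mem_image.1 hk
    have := hf1 p hp
    simp only [Finset.mem_sdiff, Finset.mem_insert, Finset.mem_singleton]
    exact ⟨hfB p hp, by omega⟩
  have hmem : ∀ p ∈ S, p.1 ∈ B ∧ p.2 ∈ B := fun p hp => Finset.mem_product.1 (hS hp)
  have e1 := aux Prod.fst (fun p hp q hq (h : p.1 = q.1) => by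
    have := hprop p hp q hq
    rw [h] at this
    exact Prod.ext h (mul_left_cancel₀ (hne _ (hmem q hq).1) this).symm)
    (fun p hp => (hmem p hp).1) h1
  have e2 := aux Prod.snd (fun p hp q hq (h : p.2 = q.2) => by
    have := hprop p hp q hq
    rw [h] at this
    exact Prod.ext (mul_right_cancel₀ (hne _ (hmem q hq).2) this) h)
    (fun p hp => (hmem p hp).2) h2
  calc ∑ p ∈ S, |squareCoeff p.1| * |squareCoeff p.2| * ρ p
      ≤ ∑ p ∈ S, (squareCoeff p.1 ^ 2 + squareCoeff p.2 ^ 2) / 2 := by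
        refine Finset.sum_le_sum fun p hp => ?_
        have h3 : |squareCoeff p.1| * |squareCoeff p.2| * ρ p
            ≤ |squareCoeff p.1| * |squareCoeff p.2| :=
          mul_le_of_le_one_right (by positivity) (hρ p hp)
        rw [← sq_abs (squareCoeff p.1), ← sq_abs (squareCoeff p.2)]
        nlinarith [sq_nonneg (|squareCoeff p.1| - |squareCoeff p.2|)]
    _ ≤ 1 / 5 := by
        rw [← Finset.sum_div, Finset.sum_add_distrib]
        linarith

theorem sum_abs_squareCoeff_mul_le_of_natAbs_eq_one (hBo : ∀ k ∈ B, Odd k) (hS : S ⊆ B ×ˢ B)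
    (hprop : ∀ p ∈ S, ∀ q ∈ S, p.1 * q.2 = q.1 * p.2) {p₀ : ℤ × ℤ} (hp₀ : p₀ ∈ S)
    (h1 : p₀.1.natAbs = 1) {ρ : ℤ × ℤ → ℝ} {r : ℤ → ℝ} (hr : ∀ k, 0 ≤ r k)
    (hρ : ∀ p ∈ S, ρ p ≤ r p.1) :
    ∑ p ∈ S, |squareCoeff p.1| * |squareCoeff p.2| * ρ p
      ≤ 1 / |(p₀.2 : ℝ)| * ∑ k ∈ B, squareCoeff k ^ 2 * r k := by
  have hne : ∀ k ∈ B, k ≠ 0 := fun k hk h => by simpa [h] using hBo k hk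
  have hmem : ∀ p ∈ S, p.1 ∈ B ∧ p.2 ∈ B := fun p hp => Finset.mem_product.1 (hS hp)
  have hinj : Set.InjOn Prod.fst (S : Set (ℤ × ℤ)) := fun p hp q hq (h : p.1 = q.1) => by
    have := hprop p hp q hq
    rw [h] at this
    exact Prod.ext h (mul_left_cancel₀ (hne _ (hmem q hq).1) this).symm
  have habs : |(p₀.1 : ℝ)| = 1 := by
    rw [← Int.cast_abs, Int.abs_eq_natAbs, h1]; simp
  have hterm : ∀ p ∈ S, |squareCoeff p.1| * |squareCoeff p.2|
      = 1 / |(p₀.2 : ℝ)| * squareCoeff p.1 ^ 2 := by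
    intro p hp
    have h : |(p.2 : ℝ)| = |(p.1 : ℝ)| * |(p₀.2 : ℝ)| := by
      have h' : (p.1 : ℝ) * p₀.2 = p₀.1 * p.2 := by exact_mod_cast hprop p hp p₀ hp₀
      rw [← abs_mul, h', abs_mul, habs, one_mul]
    rw [← sq_abs (squareCoeff p.1), abs_squareCoeff, abs_squareCoeff, h]
    simp only [div_eq_mul_inv, mul_inv]
    ring
  calc ∑ p ∈ S, |squareCoeff p.1| * |squareCoeff p.2| * ρ p
      ≤ ∑ p ∈ S, 1 / |(p₀.2 : ℝ)| * (squareCoeff p.1 ^ 2 * r p.1) := by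
        refine Finset.sum_le_sum fun p hp => ?_
        rw [hterm p hp, mul_assoc]
        gcongr
        exact hρ p hp
    _ = 1 / |(p₀.2 : ℝ)| * ∑ k ∈ S.image Prod.fst, squareCoeff k ^ 2 * r k := by
        rw [Finset.sum_image hinj, Finset.mul_sum]
    _ ≤ _ := by
        refine mul_le_mul_of_nonneg_left (Finset.sum_le_sum_of_subset_of_nonneg ?_ fun k _ _ =>
          mul_nonneg (sq_nonneg _) (hr k)) (by positivity)
        exact Finset.image_subset_iff.2 fun p hp => (hmem p hp).1

theorem sum_squareCoeff_sq_mul_ite_le (hsub : {1, -1, 3, -3} ⊆ B)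
    (hB : ∑ k ∈ B, squareCoeff k ^ 2 ≤ 1) :
    ∑ k ∈ B, squareCoeff k ^ 2 * (if k.natAbs ≤ 3 then 1 / 4 else 1) ≤ 33 / 100 := by
  have h : ∑ k ∈ B, squareCoeff k ^ 2 * (if k.natAbs ≤ 3 then 1 / 4 else 1)
      = ∑ k ∈ B, squareCoeff k ^ 2
        - ∑ k ∈ B, squareCoeff k ^ 2 * (if k.natAbs ≤ 3 then 3 / 4 else 0) := by
    rw [← Finset.sum_sub_distrib]
    refine Finset.sum_congr rfl fun k _ => ?_
    split_ifs <;> ring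
  have h2 : ∑ k ∈ ({1, -1, 3, -3} : Finset ℤ), squareCoeff k ^ 2 *
      (if k.natAbs ≤ 3 then 3 / 4 else 0)
      ≤ ∑ k ∈ B, squareCoeff k ^ 2 * (if k.natAbs ≤ 3 then 3 / 4 else 0) :=
    Finset.sum_le_sum_of_subset_of_nonneg hsub fun k _ _ =>
      mul_nonneg (sq_nonneg _) (by split_ifs <;> norm_num)
  have h3 : ∑ k ∈ ({1, -1, 3, -3} : Finset ℤ), squareCoeff k ^ 2 *
      (if k.natAbs ≤ 3 then 3 / 4 else 0) = (20 / 3) / Real.pi ^ 2 := by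
    rw [Finset.sum_insert (by decide), Finset.sum_insert (by decide),
      Finset.sum_insert (by decide), Finset.sum_singleton]
    simp only [squareCoeff_sq]
    norm_num
    field_simp
    norm_num
  have h4 : (0.67 : ℝ) ≤ (20 / 3) / Real.pi ^ 2 := by
    rw [le_div_iff₀ (by positivity)]
    linarith [pi_sq_lt]
  norm_num at h4
  linarith

end CoefficientSums

section Proportional

variable {B : Finset ℤ} {S : Finset (ℤ × ℤ)} {n : ℕ} {x y : ℤ}

theorem sum_unitMeanBound_le_of_natAbs_fst_eq_one (hsub : {1, -1, 3, -3} ⊆ B)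
    (hB : ∑ k ∈ B, squareCoeff k ^ 2 ≤ 1) (hBo : ∀ k ∈ B, Odd k) (hS : S ⊆ B ×ˢ B)
    (hprop : ∀ p ∈ S, ∀ q ∈ S, p.1 * q.2 = q.1 * p.2) (hn0 : 0 < n) (hn : n.Coprime 6)
    (hadd : ¬ (n : ℤ) ∣ x + y) (hsubt : ¬ (n : ℤ) ∣ x - y)
    {p₀ : ℤ × ℤ} (hp₀ : p₀ ∈ S) (h1 : p₀.1.natAbs = 1) :
    ∑ p ∈ S, |squareCoeff p.1| * |squareCoeff p.2| * unitMeanBound n (p.1 * x + p.2 * y) ≤ 1 / 3 ∧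
    (¬ (n : ℤ) ∣ x + 3 * y → ¬ (n : ℤ) ∣ x - 3 * y →
      ∑ p ∈ S, |squareCoeff p.1| * |squareCoeff p.2| * unitMeanBound n (p.1 * x + p.2 * y)
        ≤ 33 / 100) := by
  have hmem : ∀ p ∈ S, p.1 ∈ B ∧ p.2 ∈ B := fun p hp => Finset.mem_product.1 (hS hp)
  have hodd := hBo _ (hmem _ hp₀).2
  have hcases : p₀.1 = 1 ∨ p₀.1 = -1 := by omega
  by_cases hdvd : (n : ℤ) ∣ p₀.1 * x + p₀.2 * y
  · have hle := sum_abs_squareCoeff_mul_le_of_natAbs_eq_one hBo hS hprop hp₀ h1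
      (ρ := fun p => unitMeanBound n (p.1 * x + p.2 * y)) (r := fun _ => 1)
      (fun _ => zero_le_one) (fun p _ => unitMeanBound_le_one hn0 _)
    simp only [mul_one] at hle
    have hneg : (n : ℤ) ∣ -(p₀.1 * x + p₀.2 * y) := hdvd.neg_right
    have hl : ∀ L : ℕ, 0 < L → L ≤ p₀.2.natAbs →
        1 / |(p₀.2 : ℝ)| * ∑ k ∈ B, squareCoeff k ^ 2 ≤ 1 / L := by
      intro L hL0 hL
      have : (L : ℝ) ≤ |(p₀.2 : ℝ)| := by
        rw [← Int.cast_abs, Int.abs_eq_natAbs]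
        exact_mod_cast hL
      refine (mul_le_of_le_one_right (by positivity) hB).trans
        (one_div_le_one_div_of_le (by positivity) this)
    have hne : ∀ u : ℤ, ¬ (n : ℤ) ∣ x + u * y → ¬ (n : ℤ) ∣ x - u * y → p₀.2 ≠ u ∧ p₀.2 ≠ -u := by
      intro u hu1 hu2
      constructor <;> intro hu <;> rcases hcases with hc | hc <;> rw [hu, hc] at hdvd hneg
      · exact hu1 (by simpa using hdvd)
      · exact hu2 (by convert hneg using 1; ring)
      · exact hu2 (by convert hdvd using 1; ring)
      · exact hu1 (by convert hneg using 1; ring)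
    have hne1 := hne 1 (by simpa using hadd) (by simpa using hsubt)
    have h3 : 3 ≤ p₀.2.natAbs := by
      obtain ⟨j, hj⟩ := hodd
      omega
    refine ⟨hle.trans (by simpa using hl 3 (by norm_num) h3), fun h4 h5 => ?_⟩
    have hne3 := hne 3 h4 h5
    have h5 : 5 ≤ p₀.2.natAbs := by
      obtain ⟨j, hj⟩ := hodd
      omega
    refine hle.trans ((hl 5 (by norm_num) h5).trans (by norm_num))
  · have hle := sum_abs_squareCoeff_mul_le_of_natAbs_eq_one hBo hS hprop hp₀ h1
      (ρ := fun p => unitMeanBound n (p.1 * x + p.2 * y))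
      (r := fun k => if k.natAbs ≤ 3 then 1 / 4 else 1)
      (fun _ => by split_ifs <;> norm_num) (fun p hp => ?_)
    · have hl : 1 / |(p₀.2 : ℝ)| ≤ 1 := by
        have : (1 : ℝ) ≤ |(p₀.2 : ℝ)| := by
          rw [← Int.cast_abs]
          exact_mod_cast Int.one_le_abs (fun h => by simp [h] at hodd)
        exact div_le_one_of_le₀ this (by positivity)
      have hmain := hle.trans ((mul_le_of_le_one_left (Finset.sum_nonneg fun k _ =>
        mul_nonneg (sq_nonneg _) (by split_ifs <;> norm_num)) hl).trans
        (sum_squareCoeff_sq_mul_ite_le hsub hB))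
      exact ⟨hmain.trans (by norm_num), fun _ _ => hmain⟩
    · split_ifs with h3
      · refine unitMeanBound_le_quarter hn fun h => hdvd ?_
        have hp := hprop p hp p₀ hp₀
        have e : p.1 * x + p.2 * y = p.1 * (p₀.1 * (p₀.1 * x + p₀.2 * y)) := by
          have e1 : p₀.1 * p₀.1 = 1 := by rcases hcases with hc | hc <;> rw [hc] <;> norm_num
          linear_combination (-p.1 * x - p.2 * y) * e1 - p₀.1 * y * hp
        have hcop : IsCoprime (n : ℤ) p.1 := by
          have h6 : IsCoprime (n : ℤ) 6 := by exact_mod_cast Nat.isCoprime_iff_coprime.2 hn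
          obtain ⟨j, hj⟩ := hBo _ (hmem _ ‹p ∈ S›).1
          have : p.1 ∣ 6 := by
            have : p.1 = 1 ∨ p.1 = -1 ∨ p.1 = 3 ∨ p.1 = -3 := by omega
            rcases this with h | h | h | h <;> rw [h] <;> norm_num
          exact h6.of_isCoprime_of_dvd_right this
        rw [e] at h
        have h' := hcop.dvd_of_dvd_mul_left h
        rcases hcases with hc | hc <;> rw [hc] at h' ⊢
        · simpa using h'
        · rw [neg_one_mul, dvd_neg] at h'; exact h'
      · exact unitMeanBound_le_one hn0 _

theorem sum_unitMeanBound_le_of_proportional (hsub : {1, -1, 3, -3} ⊆ B)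
    (hB : ∑ k ∈ B, squareCoeff k ^ 2 ≤ 1) (hBo : ∀ k ∈ B, Odd k) (hS : S ⊆ B ×ˢ B)
    (hprop : ∀ p ∈ S, ∀ q ∈ S, p.1 * q.2 = q.1 * p.2) (hn0 : 0 < n) (hn : n.Coprime 6)
    (hadd : ¬ (n : ℤ) ∣ x + y) (hsubt : ¬ (n : ℤ) ∣ x - y) :
    ∑ p ∈ S, |squareCoeff p.1| * |squareCoeff p.2| * unitMeanBound n (p.1 * x + p.2 * y) ≤ 1 / 3 ∧
    (¬ (n : ℤ) ∣ x + 3 * y → ¬ (n : ℤ) ∣ x - 3 * y → ¬ (n : ℤ) ∣ 3 * x + y →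
      ¬ (n : ℤ) ∣ 3 * x - y →
      ∑ p ∈ S, |squareCoeff p.1| * |squareCoeff p.2| * unitMeanBound n (p.1 * x + p.2 * y)
        ≤ 33 / 100) := by
  by_cases h1 : ∃ p ∈ S, p.1.natAbs = 1
  · obtain ⟨p₀, hp₀, h1⟩ := h1
    have h := sum_unitMeanBound_le_of_natAbs_fst_eq_one hsub hB hBo hS hprop hn0 hn hadd hsubt
      hp₀ h1
    exact ⟨h.1, fun h2 h3 _ _ => h.2 h2 h3⟩
  by_cases h2 : ∃ p ∈ S, p.2.natAbs = 1
  · obtain ⟨p₀, hp₀, h2⟩ := h2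
    have hS' : S.map (Equiv.prodComm ℤ ℤ).toEmbedding ⊆ B ×ˢ B := by
      intro p hp
      obtain ⟨q, hq, rfl⟩ := Finset.mem_map.1 hp
      have := Finset.mem_product.1 (hS hq)
      exact Finset.mem_product.2 ⟨this.2, this.1⟩
    have hprop' : ∀ p ∈ S.map (Equiv.prodComm ℤ ℤ).toEmbedding,
        ∀ q ∈ S.map (Equiv.prodComm ℤ ℤ).toEmbedding, p.1 * q.2 = q.1 * p.2 := by
      intro p hp q hq
      obtain ⟨p, hp', rfl⟩ := Finset.mem_map.1 hp
      obtain ⟨q, hq', rfl⟩ := Finset.mem_map.1 hq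
      simpa [mul_comm] using (hprop p hp' q hq').symm
    have h := sum_unitMeanBound_le_of_natAbs_fst_eq_one hsub hB hBo hS' hprop' hn0 hn
      (x := y) (y := x) (by rwa [add_comm]) (by rwa [← dvd_neg, neg_sub])
      (Finset.mem_map_of_mem _ hp₀) h2
    have e : ∀ p : ℤ × ℤ,
        |squareCoeff p.2| * |squareCoeff p.1| * unitMeanBound n (p.2 * y + p.1 * x)
        = |squareCoeff p.1| * |squareCoeff p.2| * unitMeanBound n (p.1 * x + p.2 * y) := by
      intro p
      rw [mul_comm |squareCoeff p.2|, add_comm]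
    simp only [Finset.sum_map, Equiv.coe_toEmbedding, Equiv.prodComm_apply, Prod.fst_swap,
      Prod.snd_swap, e] at h
    exact ⟨h.1, fun _ _ h3 h4 => h.2 (by rwa [add_comm]) (by rwa [← dvd_neg, neg_sub])⟩
  · have h := sum_abs_squareCoeff_mul_le_of_natAbs_ne_one hsub hB hBo hS hprop
      (fun p hp h => h1 ⟨p, hp, h⟩) (fun p hp h => h2 ⟨p, hp, h⟩)
      (ρ := fun p => unitMeanBound n (p.1 * x + p.2 * y)) (fun p _ => unitMeanBound_le_one hn0 _)
    exact ⟨h.trans (by norm_num), fun _ _ _ _ => h.trans (by norm_num)⟩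

end Proportional

theorem mul_eq_mul_of_div_gcd_le {n D : ℕ} {x y k l k' l' : ℤ} (hx : IsCoprime (n : ℤ) x)
    (h : n / Int.gcd n (k * x + l * y) ≤ D) (h' : n / Int.gcd n (k' * x + l' * y) ≤ D)
    (hn : D ^ 2 * (k * l' - k' * l).natAbs < n) : k * l' = k' * l := by
  set d := n / Int.gcd n (k * x + l * y) with hd
  set d' := n / Int.gcd n (k' * x + l' * y) with hd'
  have hn0 : 0 < n := by omega
  have h1 : (n : ℤ) ∣ d * (k * x + l * y) := dvd_div_gcd_mul n _
  have h2 : (n : ℤ) ∣ d' * (k' * x + l' * y) := dvd_div_gcd_mul n _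
  have h3 : (n : ℤ) ∣ (d * d' * (k * l' - k' * l)) * x := by
    have e : d * d' * (k * l' - k' * l) * x
        = d' * l' * (d * (k * x + l * y)) - d * l * (d' * (k' * x + l' * y)) := by ring
    rw [e]
    exact (h1.mul_left _).sub (h2.mul_left _)
  have h4 := hx.dvd_of_dvd_mul_right h3
  have h5 : d * d' * (k * l' - k' * l) = 0 := by
    refine Int.eq_zero_of_abs_lt_dvd h4 ?_
    have : d * d' ≤ D ^ 2 := by rw [sq]; exact Nat.mul_le_mul h h'
    rw [Int.abs_eq_natAbs, Int.natAbs_mul, Int.natAbs_mul, Int.natAbs_natCast, Int.natAbs_natCast]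
    exact_mod_cast (Nat.mul_le_mul_right _ this).trans_lt hn
  have hd0 : (d : ℤ) ≠ 0 := by exact_mod_cast (div_gcd_pos hn0 _).ne'
  have hd0' : (d' : ℤ) ≠ 0 := by exact_mod_cast (div_gcd_pos hn0 _).ne'
  have := (mul_eq_zero.1 h5).resolve_left (mul_ne_zero hd0 hd0')
  linarith

theorem exists_forall_sum_unitMeanBound_le {B : Finset ℤ} (hsub : {1, -1, 3, -3} ⊆ B)
    (hB : ∑ k ∈ B, squareCoeff k ^ 2 ≤ 1) (hBo : ∀ k ∈ B, Odd k) {η : ℝ} (hη : 0 < η) :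
    ∃ N : ℕ, ∀ n : ℕ, N < n → n.Coprime 6 → ∀ x y : ℤ, IsCoprime (n : ℤ) x →
      ¬ (n : ℤ) ∣ x + y → ¬ (n : ℤ) ∣ x - y →
      ∑ p ∈ B ×ˢ B, |squareCoeff p.1| * |squareCoeff p.2| * unitMeanBound n (p.1 * x + p.2 * y)
        ≤ 1 / 3 + η ∧
      (¬ (n : ℤ) ∣ x + 3 * y → ¬ (n : ℤ) ∣ x - 3 * y → ¬ (n : ℤ) ∣ 3 * x + y →
        ¬ (n : ℤ) ∣ 3 * x - y →
        ∑ p ∈ B ×ˢ B, |squareCoeff p.1| * |squareCoeff p.2| * unitMeanBound n (p.1 * x + p.2 * y)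
          ≤ 33 / 100 + η) := by
  obtain ⟨D, hD⟩ := exists_nat_gt (((B ×ˢ B).card : ℝ) / η)
  have hD0 : 0 < D := by
    have : (0 : ℝ) < D := lt_of_le_of_lt (by positivity) hD
    exact_mod_cast this
  refine ⟨∑ q ∈ (B ×ˢ B) ×ˢ (B ×ˢ B), (D ^ 2) ^ 2 * (q.1.1 * q.2.2 - q.2.1 * q.1.2).natAbs,
    fun n hN hn x y hx hadd hsubt => ?_⟩
  have hn0 : 0 < n := by omega
  have hno : Odd n := Nat.Coprime.odd_of_right (hn.coprime_dvd_right (by norm_num : 2 ∣ 6))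
  set S := (B ×ˢ B).filter fun p => n / Int.gcd n (p.1 * x + p.2 * y) ≤ D ^ 2 with hS
  have hprop : ∀ p ∈ S, ∀ q ∈ S, p.1 * q.2 = q.1 * p.2 := by
    intro p hp q hq
    rw [hS, Finset.mem_filter] at hp hq
    refine mul_eq_mul_of_div_gcd_le hx hp.2 hq.2 (lt_of_le_of_lt ?_ hN)
    exact Finset.single_le_sum (s := (B ×ˢ B) ×ˢ (B ×ˢ B))
      (f := fun q : (ℤ × ℤ) × (ℤ × ℤ) =>
        (D ^ 2) ^ 2 * (q.1.1 * q.2.2 - q.2.1 * q.1.2).natAbs)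
      (fun _ _ => Nat.zero_le _) (Finset.mk_mem_product hp.1 hq.1)
  have hmain := sum_unitMeanBound_le_of_proportional hsub hB hBo (Finset.filter_subset _ _) hprop
    hn0 hn hadd hsubt
  have hone : ∀ k ∈ B, |squareCoeff k| ≤ 1 := by
    intro k hk
    rw [← sq_le_one_iff_abs_le_one]
    exact (Finset.single_le_sum (f := fun k => squareCoeff k ^ 2)
      (fun _ _ => sq_nonneg _) hk).trans hB
  have hrest : ∑ p ∈ (B ×ˢ B).filter fun p => ¬ n / Int.gcd n (p.1 * x + p.2 * y) ≤ D ^ 2,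
      |squareCoeff p.1| * |squareCoeff p.2| * unitMeanBound n (p.1 * x + p.2 * y) ≤ η := by
    have : ∀ p ∈ (B ×ˢ B).filter fun p => ¬ n / Int.gcd n (p.1 * x + p.2 * y) ≤ D ^ 2,
        |squareCoeff p.1| * |squareCoeff p.2| * unitMeanBound n (p.1 * x + p.2 * y) ≤ 1 / D := by
      intro p hp
      rw [Finset.mem_filter, Finset.mem_product] at hp
      refine le_trans (mul_le_of_le_one_left (unitMeanBound_nonneg _ _) ?_)
        (unitMeanBound_le_one_div_of_lt hno hD0 (not_le.1 hp.2))
      exact mul_le_one₀ (hone _ hp.1.1) (abs_nonneg _) (hone _ hp.1.2)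
    refine (Finset.sum_le_card_nsmul _ _ _ this).trans ?_
    rw [nsmul_eq_mul, mul_one_div, div_le_iff₀ (by positivity)]
    rw [div_lt_iff₀ hη] at hD
    have hc : ((((B ×ˢ B).filter fun p =>
        ¬ n / Int.gcd n (p.1 * x + p.2 * y) ≤ D ^ 2).card : ℕ) : ℝ) ≤ (B ×ˢ B).card := by
      exact_mod_cast Finset.card_filter_le _ _
    linarith
  rw [← Finset.sum_filter_add_sum_filter_not (B ×ˢ B)
    (fun p => n / Int.gcd n (p.1 * x + p.2 * y) ≤ D ^ 2)]
  exact ⟨add_le_add hmain.1 hrest, fun h1 h2 h3 h4 => add_le_add (hmain.2 h1 h2 h3 h4) hrest⟩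

section Correlation

variable {n : ℕ} [NeZero n]

theorem expect_units_mul_left {M : Type*} [AddCommMonoid M] [Module ℚ≥0 M] {u : ZMod n}
    (hu : IsUnit u) (F : ZMod n → M) :
    𝔼 g : (ZMod n)ˣ, F (u * (g : ZMod n)) = 𝔼 g : (ZMod n)ˣ, F g := by
  obtain ⟨u, rfl⟩ := hu
  exact Fintype.expect_equiv (Equiv.mulLeft u) _ _ fun g => by simp

theorem norm_expect_partialWave_mul_le (B : Finset ℤ) (x y : ℤ) :
    ‖𝔼 g : (ZMod n)ˣ, partialWave B ((x : ZMod n) * (g : ZMod n)) *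
      partialWave B ((y : ZMod n) * (g : ZMod n))‖
      ≤ ∑ p ∈ B ×ˢ B, |squareCoeff p.1| * |squareCoeff p.2| *
        unitMeanBound n (p.1 * x + p.2 * y) := by
  have h : ∀ g : (ZMod n)ˣ, partialWave B ((x : ZMod n) * (g : ZMod n)) *
      partialWave B ((y : ZMod n) * (g : ZMod n))
      = ∑ p ∈ B ×ˢ B, ((-Complex.I * squareCoeff p.1) * (-Complex.I * squareCoeff p.2)) *
        (ZMod.stdAddChar (((p.1 * x + p.2 * y : ℤ) : ZMod n) * (g : ZMod n)) : ℂ) := by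
    intro g
    rw [partialWave, partialWave, Finset.sum_mul_sum, ← Finset.sum_product']
    refine Finset.sum_congr rfl fun p _ => ?_
    have e : ((p.1 * x + p.2 * y : ℤ) : ZMod n) * (g : ZMod n)
        = (p.1 : ZMod n) * (x * (g : ZMod n)) + (p.2 : ZMod n) * (y * (g : ZMod n)) := by
      push_cast; ring
    rw [e, AddChar.map_add_eq_mul]
    ring
  simp only [h]
  rw [Finset.expect_sum_comm]
  refine (norm_sum_le _ _).trans (Finset.sum_le_sum fun p _ => ?_)
  rw [← Finset.mul_expect, norm_mul]
  refine mul_le_mul (le_of_eq ?_) (norm_expect_stdAddChar_le _) (norm_nonneg _) (by positivity)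
  simp

theorem abs_expect_squareWave_mul_le {B : Finset ℤ} {η M : ℝ} (hη : 0 < η)
    (hr : 𝔼 g : (ZMod n)ˣ, ‖(squareWave (g : ZMod n) : ℂ) - partialWave B (g : ZMod n)‖ ^ 2
      ≤ η ^ 2)
    {x y : ℤ} (hx : IsUnit (x : ZMod n)) (hy : IsUnit (y : ZMod n))
    (hM : ∑ p ∈ B ×ˢ B, |squareCoeff p.1| * |squareCoeff p.2| *
      unitMeanBound n (p.1 * x + p.2 * y) ≤ M) :
    |𝔼 g : (ZMod n)ˣ, squareWave ((x : ZMod n) * (g : ZMod n)) *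
      squareWave ((y : ZMod n) * (g : ZMod n))| ≤ M + 2 * η + η ^ 2 := by
  set R : ZMod n → ℝ := fun j => ‖(squareWave j : ℂ) - partialWave B j‖ ^ 2 with hR
  have hRx : 𝔼 g : (ZMod n)ˣ, R (x * (g : ZMod n)) ≤ η ^ 2 :=
    (expect_units_mul_left hx R).trans_le hr
  have hRy : 𝔼 g : (ZMod n)ˣ, R (y * (g : ZMod n)) ≤ η ^ 2 :=
    (expect_units_mul_left hy R).trans_le hr
  have hpt : ∀ i j : ZMod n, ‖(squareWave i : ℂ) * squareWave j - partialWave B i * partialWave B j‖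
      ≤ (1 / (2 * η) + 1 / 2) * R i + (1 / (2 * η) + 1 / 2) * R j + η := by
    intro i j
    have hb : ∀ t : ℝ, t ≤ 1 / (2 * η) * t ^ 2 + η / 2 := by
      intro t
      have : 1 / (2 * η) * t ^ 2 + η / 2 - t = (t - η) ^ 2 / (2 * η) := by
        field_simp; ring
      have : 0 ≤ (t - η) ^ 2 / (2 * η) := by positivity
      linarith
    set a := (squareWave i : ℂ) - partialWave B i with ha
    set b := (squareWave j : ℂ) - partialWave B j with hb'
    have e : (squareWave i : ℂ) * squareWave j - partialWave B i * partialWave B j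
        = squareWave i * b + squareWave j * a - a * b := by rw [ha, hb']; ring
    have hs : ∀ j : ZMod n, ‖(squareWave j : ℂ)‖ ≤ 1 := fun j => by
      rw [Complex.norm_real]; exact abs_squareWave_le_one j
    have hi : ‖(squareWave i : ℂ) * b‖ ≤ ‖b‖ := by
      rw [norm_mul]; exact mul_le_of_le_one_left (norm_nonneg _) (hs i)
    have hj : ‖(squareWave j : ℂ) * a‖ ≤ ‖a‖ := by
      rw [norm_mul]; exact mul_le_of_le_one_left (norm_nonneg _) (hs j)
    have h1 : ‖(squareWave i : ℂ) * squareWave j - partialWave B i * partialWave B j‖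
        ≤ ‖b‖ + ‖a‖ + ‖a‖ * ‖b‖ := by
      rw [e, ← norm_mul a b]
      exact (norm_sub_le _ _).trans (by gcongr; exact (norm_add_le _ _).trans (add_le_add hi hj))
    have h2 := hb ‖a‖
    have h3 := hb ‖b‖
    have h4 : R i = ‖a‖ ^ 2 := rfl
    have h5 : R j = ‖b‖ ^ 2 := rfl
    rw [h4, h5]
    nlinarith [sq_nonneg (‖a‖ - ‖b‖)]
  have hdiff : ‖(𝔼 g : (ZMod n)ˣ, (squareWave ((x : ZMod n) * (g : ZMod n)) : ℂ) *
      squareWave ((y : ZMod n) * (g : ZMod n)))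
      - 𝔼 g : (ZMod n)ˣ, partialWave B ((x : ZMod n) * (g : ZMod n)) *
      partialWave B ((y : ZMod n) * (g : ZMod n))‖ ≤ 2 * η + η ^ 2 := by
    rw [← Finset.expect_sub_distrib]
    refine (RCLike.norm_expect_le (K := ℂ)).trans
      ((Finset.expect_le_expect fun g _ => hpt _ _).trans ?_)
    rw [Finset.expect_add_distrib, Finset.expect_add_distrib, ← Finset.mul_expect,
      ← Finset.mul_expect, Fintype.expect_const]
    have h6 : (0 : ℝ) ≤ 1 / (2 * η) + 1 / 2 := by positivity
    have h7 : (1 / (2 * η) + 1 / 2) * η ^ 2 = η / 2 + η ^ 2 / 2 := by field_simp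
    nlinarith [mul_le_mul_of_nonneg_left hRx h6, mul_le_mul_of_nonneg_left hRy h6]
  have hcast : ((𝔼 g : (ZMod n)ˣ, squareWave ((x : ZMod n) * (g : ZMod n)) *
      squareWave ((y : ZMod n) * (g : ZMod n)) : ℝ) : ℂ)
      = 𝔼 g : (ZMod n)ˣ, (squareWave ((x : ZMod n) * (g : ZMod n)) : ℂ) *
      squareWave ((y : ZMod n) * (g : ZMod n)) := by
    push_cast [Complex.ofReal_expect]
    rfl
  have h8 := (norm_expect_partialWave_mul_le (n := n) B x y).trans hM
  rw [← Real.norm_eq_abs, ← Complex.norm_real, hcast]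
  have h9 := norm_le_norm_add_norm_sub'
    (𝔼 g : (ZMod n)ˣ, (squareWave ((x : ZMod n) * (g : ZMod n)) : ℂ) *
      squareWave ((y : ZMod n) * (g : ZMod n)))
    (𝔼 g : (ZMod n)ˣ, partialWave B ((x : ZMod n) * (g : ZMod n)) *
      partialWave B ((y : ZMod n) * (g : ZMod n)))
  linarith

theorem squareWave_eq_neg_one {j : ZMod n} (hj : ¬ (j.val : ℝ) / n ∈ Set.Icc (0 : ℝ) (1 / 2)) :
    squareWave j = -1 := by
  have hn : (0 : ℝ) < n := by exact_mod_cast Nat.pos_of_ne_zero (NeZero.ne n)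
  have h1 : (1 : ℝ) / 2 < (j.val : ℝ) / n := by
    by_contra! h
    exact hj ⟨by positivity, h⟩
  have h2 : (j.val : ℝ) / n < 1 := by
    rw [div_lt_one hn]
    exact_mod_cast ZMod.val_lt j
  have him : (ZMod.stdAddChar j : ℂ).im = Real.sin (2 * Real.pi * ((j.val : ℝ) / n)) := by
    rw [ZMod.stdAddChar_apply, ZMod.toCircle_apply, ← Complex.exp_ofReal_mul_I_im]
    congr 2
    push_cast
    ring
  rw [squareWave, him]
  refine Real.sign_of_neg ?_
  rw [← Real.sin_sub_two_pi]
  have := Real.pi_pos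
  exact Real.sin_neg_of_neg_of_neg_pi_lt (by nlinarith) (by nlinarith)

theorem one_add_expect_le_card (a b : ZMod n) :
    (1 + (𝔼 g : (ZMod n)ˣ, squareWave (g : ZMod n) * squareWave (a * (g : ZMod n)))
      + (𝔼 g : (ZMod n)ˣ, squareWave (g : ZMod n) * squareWave (b * (g : ZMod n)))
      + 𝔼 g : (ZMod n)ˣ, squareWave (a * (g : ZMod n)) * squareWave (b * (g : ZMod n))) / 8 *
        n.totient
      ≤ (Nat.card {g : (ZMod n)ˣ //
            ((g : ZMod n).val : ℝ) / n ∈ Set.Icc (0 : ℝ) (1 / 2) ∧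
            ((a * (g : ZMod n)).val : ℝ) / n ∈ Set.Icc (0 : ℝ) (1 / 2) ∧
            ((b * (g : ZMod n)).val : ℝ) / n ∈ Set.Icc (0 : ℝ) (1 / 2)} : ℝ) := by
  classical
  set P : ZMod n → Prop := fun j => (j.val : ℝ) / n ∈ Set.Icc (0 : ℝ) (1 / 2) with hP
  set ind : ZMod n → ℝ := fun j => if P j ∧ P (a * j) ∧ P (b * j) then 1 else 0 with hind
  have hpt : ∀ j, (1 + squareWave j) * (1 + squareWave (a * j)) * (1 + squareWave (b * j)) / 8
      ≤ ind j := by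
    intro j
    have hs : ∀ j : ZMod n, 0 ≤ 1 + squareWave j ∧ 1 + squareWave j ≤ 2 := fun j => by
      have := abs_le.1 (abs_squareWave_le_one j)
      constructor <;> linarith
    simp only [hind]
    split_ifs with h
    · have h1 : (1 + squareWave j) * (1 + squareWave (a * j)) ≤ 2 * 2 :=
        mul_le_mul (hs _).2 (hs _).2 (hs _).1 (by norm_num)
      have h2 : (1 + squareWave j) * (1 + squareWave (a * j)) * (1 + squareWave (b * j))
          ≤ 2 * 2 * 2 := mul_le_mul h1 (hs _).2 (hs _).1 (by norm_num)
      linarith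
    · rw [not_and_or, not_and_or] at h
      rcases h with h | h | h <;> rw [squareWave_eq_neg_one h] <;> simp
  have hneg : 𝔼 g : (ZMod n)ˣ, ind (-(g : ZMod n)) = 𝔼 g : (ZMod n)ˣ, ind g := by
    simpa using expect_units_mul_left (n := n) isUnit_one.neg ind
  have hE : (1 + (𝔼 g : (ZMod n)ˣ, squareWave (g : ZMod n) * squareWave (a * (g : ZMod n)))
      + (𝔼 g : (ZMod n)ˣ, squareWave (g : ZMod n) * squareWave (b * (g : ZMod n)))
      + 𝔼 g : (ZMod n)ˣ, squareWave (a * (g : ZMod n)) * squareWave (b * (g : ZMod n)))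
      ≤ 4 * ((𝔼 g : (ZMod n)ˣ, ind g) + 𝔼 g : (ZMod n)ˣ, ind (-(g : ZMod n))) := by
    rw [← Fintype.expect_one (ι := (ZMod n)ˣ) (M := ℝ), ← Finset.expect_add_distrib,
      ← Finset.expect_add_distrib, ← Finset.expect_add_distrib, ← Finset.expect_add_distrib,
      Finset.mul_expect]
    refine Finset.expect_le_expect fun g _ => ?_
    have h1 := hpt g
    have h2 := hpt (-(g : ZMod n))
    rw [mul_neg, mul_neg, squareWave_neg, squareWave_neg, squareWave_neg] at h2
    linarith
  have hcard : (𝔼 g : (ZMod n)ˣ, ind g) * n.totient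
      = (Nat.card {g : (ZMod n)ˣ // P g ∧ P (a * g) ∧ P (b * g)} : ℝ) := by
    have h0 : (n.totient : ℝ) ≠ 0 := by
      exact_mod_cast (Nat.totient_pos.2 (Nat.pos_of_ne_zero (NeZero.ne n))).ne'
    rw [Fintype.expect_eq_sum_div_card, ZMod.card_units_eq_totient, div_mul_cancel₀ _ h0,
      Nat.card_eq_fintype_card, Fintype.card_subtype]
    exact Finset.sum_boole _ _
  change _ ≤ (Nat.card {g : (ZMod n)ˣ // P g ∧ P (a * g) ∧ P (b * g)} : ℝ)
  rw [← hcard]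
  rw [hneg] at hE
  exact mul_le_mul_of_nonneg_right (by linarith) (by positivity)

end Correlation

theorem stmt1 :
    ∃ (c : ℝ) (N : ℕ), 0 < c ∧
      ∀ (n : ℕ) (a b : ℤ),
        N < n → Nat.gcd n 6 = 1 → Int.gcd a n = 1 → Int.gcd b n = 1 →
        (∀ x y : ℤ,
          ((x = 1 ∧ y = a) ∨ (x = 1 ∧ y = b) ∨ (x = a ∧ y = b)) →
          ¬ ((n : ℤ) ∣ (x + y)) ∧ ¬ ((n : ℤ) ∣ (x - y))) →
        (∃ x y : ℤ,
          ((x = 1 ∧ y = a) ∨ (x = 1 ∧ y = b) ∨ (x = a ∧ y = b)) ∧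
          ¬ ((n : ℤ) ∣ (x + 3 * y)) ∧ ¬ ((n : ℤ) ∣ (x - 3 * y)) ∧
          ¬ ((n : ℤ) ∣ (3 * x + y)) ∧ ¬ ((n : ℤ) ∣ (3 * x - y))) →
        c * (Nat.totient n : ℝ) ≤
          (Nat.card {g : (ZMod n)ˣ //
            ((g : ZMod n).val : ℝ) / n ∈ Set.Icc (0 : ℝ) (1 / 2) ∧
            ((((a : ZMod n) * (g : ZMod n)).val : ℝ) / n ∈ Set.Icc (0 : ℝ) (1 / 2)) ∧
            ((((b : ZMod n) * (g : ZMod n)).val : ℝ) / n ∈ Set.Icc (0 : ℝ) (1 / 2))} : ℝ) := by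
  obtain ⟨B, hBo, hsub, hB1, hBε⟩ :=
    exists_odd_finset_sum_squareCoeff_sq (ε := (1 / 10000) ^ 2) (by norm_num)
  obtain ⟨N₁, hN₁⟩ := eventually_atTop.1 (eventually_expect_norm_sub_partialWave_sq_le hBo hBε)
  obtain ⟨N₂, hN₂⟩ := exists_forall_sum_unitMeanBound_le hsub hB1 hBo (η := 1 / 10000) (by norm_num)
  refine ⟨1 / 4800, 2 * N₁ + N₂ + 1, by norm_num, fun n a b hn hn6 ha hb hpairs hthree => ?_⟩
  obtain ⟨m, rfl⟩ : Odd n :=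
    Nat.Coprime.odd_of_right (Nat.Coprime.coprime_dvd_right (by norm_num : 2 ∣ 6) hn6)
  have hr := hN₁ m (by omega)
  have hcop : ∀ z : ℤ, Int.gcd z (2 * m + 1 : ℕ) = 1 → IsCoprime ((2 * m + 1 : ℕ) : ℤ) z :=
    fun z hz => (Int.isCoprime_iff_gcd_eq_one.2 hz).symm
  have hunit : ∀ z : ℤ, IsCoprime ((2 * m + 1 : ℕ) : ℤ) z → IsUnit (z : ZMod (2 * m + 1)) :=
    fun z hz => (ZMod.coe_int_isUnit_iff_isCoprime z _).2 hz
  have ha' := hcop a ha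
  have hb' := hcop b hb
  set C : ℤ → ℤ → ℝ := fun x y => 𝔼 g : (ZMod (2 * m + 1))ˣ,
    squareWave ((x : ZMod (2 * m + 1)) * (g : ZMod (2 * m + 1))) *
      squareWave ((y : ZMod (2 * m + 1)) * (g : ZMod (2 * m + 1))) with hC
  have hxy : ∀ x y : ℤ, ((x = 1 ∧ y = a) ∨ (x = 1 ∧ y = b) ∨ (x = a ∧ y = b)) →
      IsCoprime ((2 * m + 1 : ℕ) : ℤ) x ∧ IsCoprime ((2 * m + 1 : ℕ) : ℤ) y := by
    rintro x y (⟨rfl, rfl⟩ | ⟨rfl, rfl⟩ | ⟨rfl, rfl⟩)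
    exacts [⟨isCoprime_one_right, ha'⟩, ⟨isCoprime_one_right, hb'⟩, ⟨ha', hb'⟩]
  have hbound : ∀ x y : ℤ, ((x = 1 ∧ y = a) ∨ (x = 1 ∧ y = b) ∨ (x = a ∧ y = b)) →
      -(1 / 3 + 1 / 1800) ≤ C x y := by
    intro x y h
    obtain ⟨hx, hy⟩ := hxy x y h
    have h1 := (hN₂ _ (by omega) hn6 x y hx (hpairs x y h).1 (hpairs x y h).2).1
    have h2 := abs_expect_squareWave_mul_le (by norm_num) hr (hunit x hx) (hunit y hy) h1
    have h3 := (abs_le.1 h2).1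
    refine le_trans ?_ h3
    norm_num
  obtain ⟨x₀, y₀, h₀, h3⟩ := hthree
  have hbound' : -(33 / 100 + 1 / 1800) ≤ C x₀ y₀ := by
    obtain ⟨hx, hy⟩ := hxy x₀ y₀ h₀
    have h1 := (hN₂ _ (by omega) hn6 x₀ y₀ hx (hpairs x₀ y₀ h₀).1 (hpairs x₀ y₀ h₀).2).2
      h3.1 h3.2.1 h3.2.2.1 h3.2.2.2
    have h2 := abs_expect_squareWave_mul_le (by norm_num) hr (hunit x₀ hx) (hunit y₀ hy) h1
    have h3 := (abs_le.1 h2).1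
    refine le_trans ?_ h3
    norm_num
  have h1a := hbound 1 a (by tauto)
  have h1b := hbound 1 b (by tauto)
  have hab := hbound a b (by tauto)
  have hsum : 1 / 600 ≤ 1 + C 1 a + C 1 b + C a b := by
    rcases h₀ with ⟨rfl, rfl⟩ | ⟨rfl, rfl⟩ | ⟨rfl, rfl⟩ <;> linarith
  have hfinal := one_add_expect_le_card (a : ZMod (2 * m + 1)) (b : ZMod (2 * m + 1))
  refine le_trans (mul_le_mul_of_nonneg_right ?_ (Nat.cast_nonneg _)) hfinal
  simp only [hC, Int.cast_one, one_mul] at hsum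
  linarith
end

section
/- Let n and G be positive integers and let A and x be integers. Then there is at most one integer y with −G ≤ y ≤ G such that gcd(xA + y, n) > √(2Gn). -/
/-- The product of two gcds with `n` is bounded by `n` times the distance of the arguments. -/
theorem gcd_mul_gcd_le_natAbs_sub_mul {n : ℕ} (hn : 0 < n) {a b : ℤ} (hab : a ≠ b) :
    Int.gcd a n * Int.gcd b n ≤ (a - b).natAbs * n := by
  rw [← Nat.gcd_mul_lcm]
  have hg : Nat.gcd (Int.gcd a n) (Int.gcd b n) ∣ (a - b).natAbs := by
    rw [← Int.natCast_dvd]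
    exact dvd_sub
      ((Int.natCast_dvd_natCast.mpr (Nat.gcd_dvd_left _ _)).trans (Int.gcd_dvd_left _ _))
      ((Int.natCast_dvd_natCast.mpr (Nat.gcd_dvd_right _ _)).trans (Int.gcd_dvd_left _ _))
  have hl : Nat.lcm (Int.gcd a n) (Int.gcd b n) ∣ n :=
    Nat.lcm_dvd (Int.natCast_dvd_natCast.mp (Int.gcd_dvd_right _ _))
      (Int.natCast_dvd_natCast.mp (Int.gcd_dvd_right _ _))
  exact Nat.mul_le_mul (Nat.le_of_dvd (Int.natAbs_pos.mpr (sub_ne_zero.mpr hab)) hg)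
    (Nat.le_of_dvd hn hl)

theorem stmt3 (n G : ℕ) (hn : 0 < n) (hG : 0 < G) (A x : ℤ) :
    ∀ y z : ℤ, -(G : ℤ) ≤ y → y ≤ G → -(G : ℤ) ≤ z → z ≤ G →
      Real.sqrt (2 * G * n) < (Int.gcd (x * A + y) n : ℝ) →
      Real.sqrt (2 * G * n) < (Int.gcd (x * A + z) n : ℝ) →
      y = z := by
  intro y z hy hy' hz hz' h₁ h₂
  by_contra hyz
  have hle : Int.gcd (x * A + y) n * Int.gcd (x * A + z) n ≤ 2 * G * n :=
    (gcd_mul_gcd_le_natAbs_sub_mul hn (by simpa using hyz)).trans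
      (Nat.mul_le_mul_right n (by lia))
  have hlt := mul_lt_mul'' h₁ h₂ (Real.sqrt_nonneg _) (Real.sqrt_nonneg _)
  rw [Real.mul_self_sqrt (by positivity)] at hlt
  exact absurd hle (not_le.mpr (by exact_mod_cast hlt))
end

section
/- Let n and G be positive integers and let A and y be integers with gcd(A, n) = 1. Then there is at most one integer x with −G ≤ x ≤ G such that gcd(xA + y, n) > √(2Gn). -/
theorem stmt4 (n G : ℕ) (hn : 0 < n) (hG : 0 < G) (A y : ℤ) (hA : Int.gcd A n = 1) :
    ∀ x w : ℤ, -(G : ℤ) ≤ x → x ≤ G → -(G : ℤ) ≤ w → w ≤ G →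
      Real.sqrt (2 * G * n) < (Int.gcd (x * A + y) n : ℝ) →
      Real.sqrt (2 * G * n) < (Int.gcd (w * A + y) n : ℝ) →
      x = w := by
  intro x w hx hx' hw hw' hdx hdw
  set d := Int.gcd (x * A + y) n
  set e := Int.gcd (w * A + y) n
  have hd : d ∣ n := Int.natCast_dvd_natCast.mp (Int.gcd_dvd_right ..)
  have he : e ∣ n := Int.natCast_dvd_natCast.mp (Int.gcd_dvd_right ..)
  have hde : 2 * G * n < d * e := by
    have h : (2 * G * n : ℝ) < d * e := by
      rw [← Real.mul_self_sqrt (show (0 : ℝ) ≤ 2 * G * n by positivity)]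
      exact mul_lt_mul'' hdx hdw (Real.sqrt_nonneg _) (Real.sqrt_nonneg _)
    exact_mod_cast h
  have hlcm : Nat.lcm d e ≤ n := Nat.le_of_dvd hn (Nat.lcm_dvd hd he)
  have hgcd : 2 * G < Nat.gcd d e := by
    refine lt_of_mul_lt_mul_right (hde.trans_le ?_) n.zero_le
    rw [← Nat.gcd_mul_lcm d e]
    exact Nat.mul_le_mul_left _ hlcm
  have hdvd_mul : (Nat.gcd d e : ℤ) ∣ (x - w) * A := by
    have h₁ : (Nat.gcd d e : ℤ) ∣ x * A + y :=
      (Int.natCast_dvd_natCast.mpr (Nat.gcd_dvd_left d e)).trans (Int.gcd_dvd_left ..)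
    have h₂ : (Nat.gcd d e : ℤ) ∣ w * A + y :=
      (Int.natCast_dvd_natCast.mpr (Nat.gcd_dvd_right d e)).trans (Int.gcd_dvd_left ..)
    have h := dvd_sub h₁ h₂
    rwa [add_sub_add_right_eq_sub, ← sub_mul] at h
  have hcop : IsCoprime (Nat.gcd d e : ℤ) A :=
    ((Int.isCoprime_iff_gcd_eq_one.mpr hA).of_isCoprime_of_dvd_right
      (Int.natCast_dvd_natCast.mpr ((Nat.gcd_dvd_left d e).trans hd))).symm
  have hzero : x - w = 0 :=
    Int.eq_zero_of_abs_lt_dvd (hcop.dvd_of_dvd_mul_right hdvd_mul) (by rw [abs_lt]; omega)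
  exact sub_eq_zero.mp hzero
end

section
/- Let n and G be positive integers, let A and x be integers, and let y and z be distinct integers with −G ≤ y ≤ G and −G ≤ z ≤ G. Then gcd(xA + y, n) · gcd(xA + z, n) ≤ 2Gn. -/
theorem stmt5 (n G : ℕ) (hn : 0 < n) (hG : 0 < G) (A x : ℤ) (y z : ℤ) (hyz : y ≠ z)
    (hy1 : -(G : ℤ) ≤ y) (hy2 : y ≤ G) (hz1 : -(G : ℤ) ≤ z) (hz2 : z ≤ G) :
    Int.gcd (x * A + y) n * Int.gcd (x * A + z) n ≤ 2 * G * n := by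
  set a := Int.gcd (x * A + y) n
  set b := Int.gcd (x * A + z) n
  have ha : (a : ℤ) ∣ x * A + y := Int.gcd_dvd_left ..
  have hb : (b : ℤ) ∣ x * A + z := Int.gcd_dvd_left ..
  have han : a ∣ n := Int.natCast_dvd_natCast.mp (Int.gcd_dvd_right ..)
  have hbn : b ∣ n := Int.natCast_dvd_natCast.mp (Int.gcd_dvd_right ..)
  have hdvd : ((Nat.gcd a b : ℕ) : ℤ) ∣ y - z := by
    have h := dvd_sub ((Int.natCast_dvd_natCast.mpr (Nat.gcd_dvd_left a b)).trans ha)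
      ((Int.natCast_dvd_natCast.mpr (Nat.gcd_dvd_right a b)).trans hb)
    rwa [add_sub_add_left_eq_sub] at h
  have hgcd : Nat.gcd a b ≤ 2 * G := by
    have h := Nat.le_of_dvd (by omega) (Int.natCast_dvd.mp hdvd)
    omega
  have hlcm : Nat.lcm a b ≤ n := Nat.le_of_dvd hn (Nat.lcm_dvd han hbn)
  rw [← Nat.gcd_mul_lcm a b]
  exact Nat.mul_le_mul hgcd hlcm
end

section
/- Let n be a positive integer with gcd(n,6)=1, and let a, b, c be integers with 1 ≤ a, b, c ≤ n−1 and 1 + a + b + c = 2n, such that (1)(a)(b)(c) is a minimal zero-sum sequence over ℤ/n whose index equals 2. Then at least one of the pairs (x,y) ∈ {(1,a),(1,b),(a,b)} satisfies none of the congruences x + 3y ≡ 0, x − 3y ≡ 0, 3x + y ≡ 0, 3x − y ≡ 0 (mod n). -/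
/-- The least residues of any unit multiple of a sequence sum to at least `n` times its index. -/
theorem seqIndex_mul_le_sum_val (n : ℕ) [NeZero n] {k : ℕ} (a : Fin k → ZMod n) (g : (ZMod n)ˣ) :
    seqIndex n a * n ≤ ∑ j, (((g : ZMod n) * a j).val : ℚ) := by
  have hn : (n : ℚ) ≠ 0 := Nat.cast_ne_zero.mpr (NeZero.ne n)
  rw [seqIndex, dif_neg (NeZero.ne n), div_mul_cancel₀ _ hn]
  exact Finset.inf'_le _ (Finset.mem_univ g)

/-- A sequence with a unit multiple whose least residues sum to `n` does not have index `2`. -/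
theorem seqIndex_ne_two_of_sum_val_eq (n : ℕ) [NeZero n] {k : ℕ} (a : Fin k → ZMod n)
    (g : (ZMod n)ˣ) (h : ∑ j, ((g : ZMod n) * a j).val = n) : seqIndex n a ≠ 2 := by
  intro h2
  have hle := seqIndex_mul_le_sum_val n a g
  rw [h2, ← Nat.cast_sum, h] at hle
  have hpos : (0 : ℚ) < n := Nat.cast_pos.mpr (NeZero.pos n)
  linarith

/-- If `1`, `x`, `y` pairwise differ by a factor `±3` modulo `n`, where `n` is prime to `6`,
then `n` divides `91`. -/
theorem dvd_ninety_one_of_sq_ratios {n : ℕ} (h6 : Nat.gcd n 6 = 1) (x y : ZMod n)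
    (hx : x ^ 2 = 9 ∨ 9 * x ^ 2 = 1) (hy : y ^ 2 = 9 ∨ 9 * y ^ 2 = 1)
    (hxy : x ^ 2 = 9 * y ^ 2 ∨ 9 * x ^ 2 = y ^ 2) : n ∣ 91 := by
  have h : ((6 ^ 3 * 91 : ℕ) : ZMod n) = 0 := by
    push_cast
    rcases hx with hx | hx <;> rcases hy with hy | hy <;> rcases hxy with hxy | hxy <;> grind
  rw [ZMod.natCast_eq_zero_iff] at h
  exact (Nat.Coprime.pow_right 3 h6).dvd_of_dvd_mul_left h

/-- If `y` is `±3` or `±1/3` times `x` modulo `n`, then `y ^ 2` is `9` or `1/9` times `x ^ 2`. -/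
theorem sq_ratio_of_dvd {n : ℕ} {x y : ℤ}
    (h : (n : ℤ) ∣ x + 3 * y ∨ (n : ℤ) ∣ x - 3 * y ∨ (n : ℤ) ∣ 3 * x + y ∨ (n : ℤ) ∣ 3 * x - y) :
    (x : ZMod n) ^ 2 = 9 * (y : ZMod n) ^ 2 ∨ 9 * (x : ZMod n) ^ 2 = (y : ZMod n) ^ 2 := by
  simp only [← CharP.intCast_eq_zero_iff (ZMod n) n] at h
  push_cast at h
  rcases h with h | h | h | h
  · left; linear_combination (x - 3 * y : ZMod n) * h
  · left; linear_combination (x + 3 * y : ZMod n) * h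
  · right; linear_combination (3 * x - y : ZMod n) * h
  · right; linear_combination (3 * x + y : ZMod n) * h

theorem stmt9 (n : ℕ) (hn : 0 < n) (h6 : Nat.gcd n 6 = 1) (a b c : ℤ)
    (ha : 1 ≤ a ∧ a ≤ (n : ℤ) - 1) (hb : 1 ≤ b ∧ b ≤ (n : ℤ) - 1)
    (hc : 1 ≤ c ∧ c ≤ (n : ℤ) - 1)
    (hsum : 1 + a + b + c = 2 * n)
    (hmin : IsMinZeroSum n ![1, (a : ZMod n), (b : ZMod n), (c : ZMod n)])
    (hind : seqIndex n ![1, (a : ZMod n), (b : ZMod n), (c : ZMod n)] = 2) :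
    ∃ x y : ℤ,
      ((x = 1 ∧ y = a) ∨ (x = 1 ∧ y = b) ∨ (x = a ∧ y = b)) ∧
      ¬ ((n : ℤ) ∣ (x + 3 * y)) ∧ ¬ ((n : ℤ) ∣ (x - 3 * y)) ∧
      ¬ ((n : ℤ) ∣ (3 * x + y)) ∧ ¬ ((n : ℤ) ∣ (3 * x - y)) := by
  by_contra! hcon
  have key : ∀ x y : ℤ, ((x = 1 ∧ y = a) ∨ (x = 1 ∧ y = b) ∨ (x = a ∧ y = b)) →
      ((n : ℤ) ∣ x + 3 * y ∨ (n : ℤ) ∣ x - 3 * y ∨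
        (n : ℤ) ∣ 3 * x + y ∨ (n : ℤ) ∣ 3 * x - y) := by
    intro x y hxy
    have := hcon x y hxy
    tauto
  have h1a := key 1 a (by simp)
  have h1b := key 1 b (by simp)
  have hab := key a b (by simp)
  have hdvd : n ∣ 91 := by
    refine dvd_ninety_one_of_sq_ratios h6 (a : ZMod n) (b : ZMod n) ?_ ?_ (sq_ratio_of_dvd hab)
    · have := sq_ratio_of_dvd h1a
      simp only [Int.cast_one, one_pow, mul_one] at this
      exact this.symm.imp Eq.symm Eq.symm
    · have := sq_ratio_of_dvd h1b
      simp only [Int.cast_one, one_pow, mul_one] at this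
      exact this.symm.imp Eq.symm Eq.symm
  have hcases : n = 1 ∨ n = 7 ∨ n = 13 ∨ n = 91 := by
    have hmem : n ∈ Nat.divisors 91 := Nat.mem_divisors.mpr ⟨hdvd, by norm_num⟩
    rw [show Nat.divisors 91 = {1, 7, 13, 91} by decide +kernel] at hmem
    simpa using hmem
  clear key hcon hmin
  rcases hcases with rfl | rfl | rfl | rfl
  · omega
  · have habc : (a = 3 ∧ b = 5 ∧ c = 5) ∨ (a = 5 ∧ b = 3 ∧ c = 5) ∨
        (a = 4 ∧ b = 5 ∧ c = 4) ∨ (a = 5 ∧ b = 4 ∧ c = 4) := by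
      clear hind
      have ha' : a = 2 ∨ a = 3 ∨ a = 4 ∨ a = 5 := by
        clear h1b hab
        omega
      have hb' : b = 2 ∨ b = 3 ∨ b = 4 ∨ b = 5 := by
        clear h1a hab ha'
        omega
      clear h1a h1b
      rcases ha' with rfl | rfl | rfl | rfl <;> rcases hb' with rfl | rfl | rfl | rfl <;> omega
    rcases habc with ⟨rfl, rfl, rfl⟩ | ⟨rfl, rfl, rfl⟩ | ⟨rfl, rfl, rfl⟩ | ⟨rfl, rfl, rfl⟩
    · exact seqIndex_ne_two_of_sum_val_eq 7 _ (ZMod.unitOfCoprime 3 (by norm_num)) (by decide) hind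
    · exact seqIndex_ne_two_of_sum_val_eq 7 _ (ZMod.unitOfCoprime 3 (by norm_num)) (by decide) hind
    · exact seqIndex_ne_two_of_sum_val_eq 7 _ (ZMod.unitOfCoprime 2 (by norm_num)) (by decide) hind
    · exact seqIndex_ne_two_of_sum_val_eq 7 _ (ZMod.unitOfCoprime 2 (by norm_num)) (by decide) hind
  · have habc : (a = 10 ∧ b = 9 ∧ c = 6) ∨ (a = 9 ∧ b = 10 ∧ c = 6) ∨
        (a = 10 ∧ b = 4 ∧ c = 11) ∨ (a = 4 ∧ b = 10 ∧ c = 11) := by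
      clear hind
      have ha' : a = 3 ∨ a = 4 ∨ a = 9 ∨ a = 10 := by
        clear h1b hab
        omega
      have hb' : b = 3 ∨ b = 4 ∨ b = 9 ∨ b = 10 := by
        clear h1a hab ha'
        omega
      clear h1a h1b
      rcases ha' with rfl | rfl | rfl | rfl <;> rcases hb' with rfl | rfl | rfl | rfl <;> omega
    rcases habc with ⟨rfl, rfl, rfl⟩ | ⟨rfl, rfl, rfl⟩ | ⟨rfl, rfl, rfl⟩ | ⟨rfl, rfl, rfl⟩
    · exact seqIndex_ne_two_of_sum_val_eq 13 _ (ZMod.unitOfCoprime 3 (by norm_num)) (by decide) hind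
    · exact seqIndex_ne_two_of_sum_val_eq 13 _ (ZMod.unitOfCoprime 3 (by norm_num)) (by decide) hind
    · exact seqIndex_ne_two_of_sum_val_eq 13 _ (ZMod.unitOfCoprime 4 (by norm_num)) (by decide) hind
    · exact seqIndex_ne_two_of_sum_val_eq 13 _ (ZMod.unitOfCoprime 4 (by norm_num)) (by decide) hind
  · have ha' : a = 3 ∨ a = 88 ∨ a = 30 ∨ a = 61 := by
      clear hind h1b hab
      omega
    have hb' : b = 3 ∨ b = 88 ∨ b = 30 ∨ b = 61 := by
      clear hind h1a hab ha'
      omega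
    clear hind h1a h1b
    rcases ha' with rfl | rfl | rfl | rfl <;> rcases hb' with rfl | rfl | rfl | rfl <;> omega
end

section
/- Let n be a positive integer, let A be an integer with gcd(A, n) = 1, let H be a positive integer, and let t be a nonzero integer with |t| ≤ H and gcd(A + t, n) > H·√(2n). Then for every integer k with 0 < |k| ≤ H and every integer m with |m| ≤ H² and gcd(Ak + m, n) > H·√(2n), one has m = k·t. -/
/-- Two divisors of `n` whose product exceeds `c * n` have greatest common divisor above `c`. -/
theorem Nat.lt_gcd_of_mul_lt_mul_of_dvd {a b c n : ℕ} (hn : 0 < n) (ha : a ∣ n) (hb : b ∣ n)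
    (h : c * n < a * b) : c < Nat.gcd a b := by
  have hl : Nat.lcm a b ≤ n := Nat.le_of_dvd hn (Nat.lcm_dvd ha hb)
  rw [← Nat.gcd_mul_lcm a b] at h
  exact lt_of_mul_lt_mul_right (h.trans_le (Nat.mul_le_mul_left _ hl)) n.zero_le

theorem stmt11 (n : ℕ) (hn : 0 < n) (A : ℤ) (hA : Int.gcd A n = 1)
    (H : ℕ) (hH : 0 < H) (t : ℤ) (ht0 : t ≠ 0) (htH : |t| ≤ (H : ℤ))
    (htg : (H : ℝ) * Real.sqrt (2 * n) < (Int.gcd (A + t) n : ℝ)) :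
    ∀ k m : ℤ, 0 < |k| → |k| ≤ (H : ℤ) → |m| ≤ (H : ℤ) ^ 2 →
      (H : ℝ) * Real.sqrt (2 * n) < (Int.gcd (A * k + m) n : ℝ) →
      m = k * t := by
  intro k m _ hkH hm hmg
  set a := Int.gcd (A + t) n
  set b := Int.gcd (A * k + m) n
  have hprod : 2 * H ^ 2 * n < a * b := by
    have h := mul_lt_mul'' htg hmg (by positivity) (by positivity)
    have hs : Real.sqrt (2 * n) * Real.sqrt (2 * n) = 2 * n :=
      Real.mul_self_sqrt (by positivity)
    rw [mul_mul_mul_comm, hs] at h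
    have h' : ((2 * H ^ 2 * n : ℕ) : ℝ) < ((a * b : ℕ) : ℝ) := by
      push_cast
      linarith
    exact_mod_cast h'
  have hgcd : 2 * H ^ 2 < Nat.gcd a b :=
    Nat.lt_gcd_of_mul_lt_mul_of_dvd hn (Int.natCast_dvd_natCast.mp (Int.gcd_dvd_right _ _))
      (Int.natCast_dvd_natCast.mp (Int.gcd_dvd_right _ _)) hprod
  have hdvd : (Nat.gcd a b : ℤ) ∣ m - k * t := by
    have h₁ : (Nat.gcd a b : ℤ) ∣ A + t :=
      (Int.natCast_dvd_natCast.mpr (Nat.gcd_dvd_left a b)).trans (Int.gcd_dvd_left _ _)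
    have h₂ : (Nat.gcd a b : ℤ) ∣ A * k + m :=
      (Int.natCast_dvd_natCast.mpr (Nat.gcd_dvd_right a b)).trans (Int.gcd_dvd_left _ _)
    have h := dvd_sub h₂ (h₁.mul_left k)
    rwa [show A * k + m - k * (A + t) = m - k * t by ring] at h
  have hbound : |m - k * t| ≤ 2 * (H : ℤ) ^ 2 := by
    have hkt : |k * t| ≤ (H : ℤ) * H := by
      rw [abs_mul]
      exact mul_le_mul hkH htH (abs_nonneg t) (by positivity)
    linarith [abs_sub m (k * t)]
  have hlt : |m - k * t| < (Nat.gcd a b : ℤ) := hbound.trans_lt (by exact_mod_cast hgcd)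
  exact sub_eq_zero.mp (Int.eq_zero_of_abs_lt_dvd hdvd hlt)
end
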